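/- arXiv:1506.08741 — 17 statements merged into one kernel-verified Lean document; each statement's English description precedes it below -/
import Mathlib

section
/- In the polynomial ring ℝ[x,y,z], the ideal generated by x²+y²+z², x⁴+y⁴+z⁴, and xyz is equal to the ideal generated by the five polynomials x²+y²+z², xyz, y⁴+y²z²+z⁴, y³z+yz³, and z⁵. -/
open MvPolynomial

/-- The ideal generated by `x²+y²+z²`, `x⁴+y⁴+z⁴` and `xyz` in a commutative ring in which `2` is
invertible. -/
theorem span_powerSums_eq_span {R : Type*} [CommRing R] (x y z : R) (h2 : IsUnit (2 : R)) :
    Ideal.span {x ^ 2 + y ^ 2 + z ^ 2, x ^ 4 + y ^ 4 + z ^ 4, x * y * z} =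
      Ideal.span {x ^ 2 + y ^ 2 + z ^ 2, x * y * z, y ^ 4 + y ^ 2 * z ^ 2 + z ^ 4,
        y ^ 3 * z + y * z ^ 3, z ^ 5} := by
  apply le_antisymm <;> rw [Ideal.span_le]
  · set J := Ideal.span {x ^ 2 + y ^ 2 + z ^ 2, x * y * z, y ^ 4 + y ^ 2 * z ^ 2 + z ^ 4,
      y ^ 3 * z + y * z ^ 3, z ^ 5}
    have hs : x ^ 2 + y ^ 2 + z ^ 2 ∈ J := Ideal.subset_span (by simp)
    have he : x * y * z ∈ J := Ideal.subset_span (by simp)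
    have hg : y ^ 4 + y ^ 2 * z ^ 2 + z ^ 4 ∈ J := Ideal.subset_span (by simp)
    have ht : x ^ 4 + y ^ 4 + z ^ 4 ∈ J := by
      convert J.add_mem (J.mul_mem_left (x ^ 2 - y ^ 2 - z ^ 2) hs) (J.mul_mem_left 2 hg) using 1
      ring
    rintro p (rfl | rfl | rfl) <;> assumption
  · set I := Ideal.span {x ^ 2 + y ^ 2 + z ^ 2, x ^ 4 + y ^ 4 + z ^ 4, x * y * z}
    have hs : x ^ 2 + y ^ 2 + z ^ 2 ∈ I := Ideal.subset_span (by simp)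
    have ht : x ^ 4 + y ^ 4 + z ^ 4 ∈ I := Ideal.subset_span (by simp)
    have he : x * y * z ∈ I := Ideal.subset_span (by simp)
    have hg : y ^ 4 + y ^ 2 * z ^ 2 + z ^ 4 ∈ I := by
      rw [← I.unit_mul_mem_iff_mem h2]
      convert I.sub_mem ht (I.mul_mem_left (x ^ 2 - y ^ 2 - z ^ 2) hs) using 1
      ring
    have hh : y ^ 3 * z + y * z ^ 3 ∈ I := by
      convert I.sub_mem (I.mul_mem_left (y * z) hs) (I.mul_mem_left x he) using 1
      ring
    have hz : z ^ 5 ∈ I := by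
      convert I.sub_mem (I.mul_mem_left z hg) (I.mul_mem_left y hh) using 1
      ring
    rintro p (rfl | rfl | rfl | rfl | rfl) <;> assumption

/-- In ℝ[x,y,z], the ideal generated by `x²+y²+z²`, `x⁴+y⁴+z⁴` and `xyz` equals the ideal
generated by the Gröbner basis `x²+y²+z²`, `xyz`, `y⁴+y²z²+z⁴`, `y³z+yz³`, `z⁵`. -/
theorem groebner_basis_ideal_eq :
    (Ideal.span {(X 0 ^ 2 + X 1 ^ 2 + X 2 ^ 2 : MvPolynomial (Fin 3) ℝ),
        X 0 ^ 4 + X 1 ^ 4 + X 2 ^ 4,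
        X 0 * X 1 * X 2} : Ideal (MvPolynomial (Fin 3) ℝ)) =
      Ideal.span {(X 0 ^ 2 + X 1 ^ 2 + X 2 ^ 2 : MvPolynomial (Fin 3) ℝ),
        X 0 * X 1 * X 2,
        X 1 ^ 4 + X 1 ^ 2 * X 2 ^ 2 + X 2 ^ 4,
        X 1 ^ 3 * X 2 + X 1 * X 2 ^ 3,
        X 2 ^ 5} := by
  exact span_powerSums_eq_span _ _ _ <|
    map_ofNat (C (σ := Fin 3) (R := ℝ)) 2 ▸ (IsUnit.mk0 (2 : ℝ) two_ne_zero).map C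
end

section
/- In the polynomial ring ℝ[x,y,z], the polynomial y²z³ − yz⁴ does not belong to the ideal generated by x²+y²+z², x⁴+y⁴+z⁴, and xyz; equivalently, the class of y²z³ − yz⁴ is nonzero in the quotient ring ℝ[x,y,z]/⟨x²+y²+z², x⁴+y⁴+z⁴, xyz⟩. -/
open MvPolynomial

/-- The exponent vector of the monomial `x^i y^j z^k`. -/
noncomputable def expVec (i j k : ℕ) : Fin 3 →₀ ℕ :=
  Finsupp.equivFunOnFinite.symm ![i, j, k]

theorem coeff_expVec_mul_monomial (p : MvPolynomial (Fin 3) ℝ) (i j k a b c : ℕ) :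
    coeff (expVec i j k) (p * monomial (expVec a b c) 1) =
      if a ≤ i ∧ b ≤ j ∧ c ≤ k then coeff (expVec (i - a) (j - b) (k - c)) p else 0 := by
  have hle : expVec a b c ≤ expVec i j k ↔ a ≤ i ∧ b ≤ j ∧ c ≤ k := by
    simp [Finsupp.le_def, Fin.forall_fin_succ, expVec]
  have hsub : expVec i j k - expVec a b c = expVec (i - a) (j - b) (k - c) := by
    ext t
    fin_cases t <;> simp [expVec]
  rw [coeff_mul_monomial', hsub, mul_one]
  exact if_congr hle rfl rfl

theorem monomial_expVec (a b c : ℕ) :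
    monomial (expVec a b c) (1 : ℝ) = X 0 ^ a * X 1 ^ b * X 2 ^ c := by
  rw [monomial_eq, Finsupp.prod_fintype _ _ (by simp)]
  simp [Fin.prod_univ_three, expVec]

/-- A functional on `ℝ[x,y,z]`, supported in degree five, that annihilates the ideal generated by
`x²+y²+z²`, `x⁴+y⁴+z⁴` and `xyz`. -/
noncomputable def quinticFunctional (p : MvPolynomial (Fin 3) ℝ) : ℝ :=
  coeff (expVec 0 2 3) p - coeff (expVec 2 0 3) p - coeff (expVec 0 4 1) p +
    coeff (expVec 4 0 1) p

theorem quinticFunctional_eq_zero (a b c : MvPolynomial (Fin 3) ℝ) :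
    quinticFunctional (a * (X 0 ^ 2 + X 1 ^ 2 + X 2 ^ 2) +
      (b * (X 0 ^ 4 + X 1 ^ 4 + X 2 ^ 4) + c * (X 0 * X 1 * X 2))) = 0 := by
  have h : a * (X 0 ^ 2 + X 1 ^ 2 + X 2 ^ 2) +
      (b * (X 0 ^ 4 + X 1 ^ 4 + X 2 ^ 4) + c * (X 0 * X 1 * X 2)) =
      a * monomial (expVec 2 0 0) 1 + a * monomial (expVec 0 2 0) 1 +
      a * monomial (expVec 0 0 2) 1 + b * monomial (expVec 4 0 0) 1 +
      b * monomial (expVec 0 4 0) 1 + b * monomial (expVec 0 0 4) 1 +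
      c * monomial (expVec 1 1 1) 1 := by
    simp only [monomial_expVec]
    ring
  rw [h]
  simp only [quinticFunctional, coeff_add, coeff_expVec_mul_monomial]
  norm_num
  ring

theorem quinticFunctional_top_class :
    quinticFunctional (X 1 ^ 2 * X 2 ^ 3 - X 1 * X 2 ^ 4) = 1 := by
  have h : (X 1 ^ 2 * X 2 ^ 3 - X 1 * X 2 ^ 4 : MvPolynomial (Fin 3) ℝ) =
      1 * monomial (expVec 0 2 3) 1 - 1 * monomial (expVec 0 1 4) 1 := by
    simp only [monomial_expVec]
    ring
  have h0 : expVec 0 0 0 = 0 := by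
    ext t
    fin_cases t <;> simp [expVec]
  rw [h]
  simp only [quinticFunctional, coeff_sub, coeff_expVec_mul_monomial]
  norm_num [h0]

/-- In ℝ[x,y,z], the polynomial `y²z³ − yz⁴` does not belong to the ideal generated by
`x²+y²+z²`, `x⁴+y⁴+z⁴` and `xyz`; i.e. its class is nonzero in the quotient ring. -/
theorem top_class_not_in_ideal :
    (X 1 ^ 2 * X 2 ^ 3 - X 1 * X 2 ^ 4 : MvPolynomial (Fin 3) ℝ) ∉
      (Ideal.span {(X 0 ^ 2 + X 1 ^ 2 + X 2 ^ 2 : MvPolynomial (Fin 3) ℝ),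
        X 0 ^ 4 + X 1 ^ 4 + X 2 ^ 4,
        X 0 * X 1 * X 2} : Ideal (MvPolynomial (Fin 3) ℝ)) := by
  intro hmem
  obtain ⟨a, u, hu, h⟩ := Ideal.mem_span_insert.mp hmem
  obtain ⟨b, c, rfl⟩ := Ideal.mem_span_pair.mp hu
  have h1 := quinticFunctional_top_class
  rw [h, quinticFunctional_eq_zero] at h1
  exact zero_ne_one h1
end

section
/- Let V be a finite-dimensional real vector space, let y and z be alternating 2-forms on V, and let v, w ∈ V satisfy ι_v y = 0 and ι_w z = 0, where ι denotes the interior product. Assume that in the exterior algebra of V* one has y⁴ + y²∧z² + z⁴ = 0 and y³∧z + y∧z³ = 0 (all powers being wedge powers). Then ι_w(ι_v(y²∧z³ − y∧z⁴)) = 0. -/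
set_option synthInstance.maxHeartbeats 1000000
set_option maxHeartbeats 1000000

/-- The interior product (contraction) with vectors of `V`, acting on the exterior algebra of
the dual space of `V`, as a linear map in the vector. -/
noncomputable def interiorProduct (R : Type*) (V : Type*) [CommRing R] [AddCommGroup V]
    [Module R V] :
    V →ₗ[R] ExteriorAlgebra R (Module.Dual R V) →ₗ[R] ExteriorAlgebra R (Module.Dual R V) :=
  CliffordAlgebra.contractLeft ∘ₗ Module.Dual.eval R V

section InteriorProduct

variable {R V : Type*} [CommRing R] [AddCommGroup V] [Module R V]

open ExteriorAlgebra in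
/-- Elements of degree two are central in the exterior algebra. -/
theorem ExteriorAlgebra.commute_of_mem_exteriorPower_two {M : Type*} [AddCommGroup M] [Module R M]
    {x : ExteriorAlgebra R M} (hx : x ∈ ⋀[R]^2 M) (t : ExteriorAlgebra R M) : Commute x t := by
  change x ∈ LinearMap.range (ι R) ^ 2 at hx
  rw [pow_two] at hx
  induction hx using Submodule.mul_induction_on' with
  | mem_mul_mem p hp q hq =>
    obtain ⟨p, rfl⟩ := hp
    obtain ⟨q, rfl⟩ := hq
    induction t using ExteriorAlgebra.induction with
    | algebraMap r => exact (Algebra.commutes r _).symm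
    | ι c =>
      have anticomm (a b : M) : ι R a * ι R b = -(ι R b * ι R a) :=
        eq_neg_of_add_eq_zero_left (ι_add_mul_swap a b)
      change ι R p * ι R q * ι R c = ι R c * (ι R p * ι R q)
      rw [mul_assoc, anticomm q c, mul_neg, ← mul_assoc, anticomm p c, neg_mul, neg_neg, mul_assoc]
    | mul a b ha hb => exact ha.mul_right hb
    | add a b ha hb => exact ha.add_right hb
  | add x _ y _ hx hy => exact hx.add_left hy

theorem interiorProduct_interiorProduct_comm (v w : V) (x : ExteriorAlgebra R (Module.Dual R V)) :
    interiorProduct R V v (interiorProduct R V w x) =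
      -interiorProduct R V w (interiorProduct R V v x) :=
  CliffordAlgebra.contractLeft_comm _ _ x

theorem interiorProduct_interiorProduct (v : V) (x : ExteriorAlgebra R (Module.Dual R V)) :
    interiorProduct R V v (interiorProduct R V v x) = 0 :=
  CliffordAlgebra.contractLeft_contractLeft _ x

theorem interiorProduct_one (v : V) : interiorProduct R V v 1 = 0 :=
  CliffordAlgebra.contractLeft_one _ _

theorem interiorProduct_ι (v : V) (f : Module.Dual R V) :
    interiorProduct R V v (ExteriorAlgebra.ι R f) = algebraMap R _ (f v) :=
  CliffordAlgebra.contractLeft_ι _ _ f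

theorem interiorProduct_ι_mul (v : V) (f : Module.Dual R V)
    (t : ExteriorAlgebra R (Module.Dual R V)) :
    interiorProduct R V v (ExteriorAlgebra.ι R f * t) =
      f v • t - ExteriorAlgebra.ι R f * interiorProduct R V v t :=
  CliffordAlgebra.contractLeft_ι_mul _ f t

/-- The Leibniz rule for the interior product when the left factor has degree two. -/
theorem interiorProduct_mul_of_mem_exteriorPower_two (v : V)
    {x : ExteriorAlgebra R (Module.Dual R V)} (hx : x ∈ ⋀[R]^2 (Module.Dual R V))
    (t : ExteriorAlgebra R (Module.Dual R V)) :
    interiorProduct R V v (x * t) =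
      interiorProduct R V v x * t + x * interiorProduct R V v t := by
  change x ∈ LinearMap.range (ExteriorAlgebra.ι R) ^ 2 at hx
  rw [pow_two] at hx
  induction hx using Submodule.mul_induction_on' with
  | mem_mul_mem p hp q hq =>
    obtain ⟨p, rfl⟩ := hp
    obtain ⟨q, rfl⟩ := hq
    rw [mul_assoc]
    simp only [interiorProduct_ι_mul, interiorProduct_ι, ← Algebra.commutes, ← Algebra.smul_def,
      mul_sub, sub_mul, smul_mul_assoc, mul_smul_comm, mul_assoc]
    abel
  | add x _ y _ hx hy =>
    rw [add_mul, map_add, hx, hy, map_add, add_mul, add_mul]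
    abel

theorem interiorProduct_pow_mul_of_mem_exteriorPower_two (v : V)
    {x : ExteriorAlgebra R (Module.Dual R V)} (hx : x ∈ ⋀[R]^2 (Module.Dual R V)) (n : ℕ)
    (t : ExteriorAlgebra R (Module.Dual R V)) :
    interiorProduct R V v (x ^ n * t) =
      n • (x ^ (n - 1) * (interiorProduct R V v x * t)) + x ^ n * interiorProduct R V v t := by
  induction n with
  | zero => simp
  | succ n ih =>
    have hc := ExteriorAlgebra.commute_of_mem_exteriorPower_two hx
    rw [pow_succ', mul_assoc, interiorProduct_mul_of_mem_exteriorPower_two v hx, ih, mul_add,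
      ← mul_assoc (interiorProduct R V v x), ((hc _).pow_left n).symm.eq, Nat.add_sub_cancel,
      mul_smul_comm, mul_assoc (x ^ n), ← mul_assoc x (x ^ n), ← add_assoc]
    congr 1
    cases n with
    | zero => simp
    | succ n => rw [Nat.add_sub_cancel, ← mul_assoc x, ← pow_succ', succ_nsmul' _ (n + 1)]

/-- If `ι_v y = 0` and `ι_w z = 0`, then `ι_w ∘ ι_v` acts on polynomials in the two-forms `y`, `z`
as the mixed second partial derivative, multiplied by `ι_w y ∧ ι_v z`. -/
theorem interiorProduct_interiorProduct_pow_mul_pow {y z : ExteriorAlgebra R (Module.Dual R V)}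
    (hy : y ∈ ⋀[R]^2 (Module.Dual R V)) (hz : z ∈ ⋀[R]^2 (Module.Dual R V)) {v w : V}
    (hv : interiorProduct R V v y = 0) (hw : interiorProduct R V w z = 0) (m n : ℕ) :
    interiorProduct R V w (interiorProduct R V v (y ^ m * z ^ n)) =
      (m * n) • (y ^ (m - 1) * z ^ (n - 1) *
        (interiorProduct R V w y * interiorProduct R V v z)) := by
  have hzc := ((ExteriorAlgebra.commute_of_mem_exteriorPower_two hz
    (interiorProduct R V w y)).pow_left (n - 1)).symm
  have hwv : interiorProduct R V w (interiorProduct R V v z) = 0 := by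
    rw [interiorProduct_interiorProduct_comm, hw, map_zero, neg_zero]
  have hvz : interiorProduct R V v (z ^ n) = n • (z ^ (n - 1) * interiorProduct R V v z) := by
    simpa [interiorProduct_one] using
      interiorProduct_pow_mul_of_mem_exteriorPower_two v hz n 1
  have hwz : interiorProduct R V w (z ^ (n - 1) * interiorProduct R V v z) = 0 := by
    simp [interiorProduct_pow_mul_of_mem_exteriorPower_two w hz, hw, hwv]
  rw [interiorProduct_pow_mul_of_mem_exteriorPower_two v hy, hv, hvz, zero_mul, mul_zero,
    smul_zero, zero_add, mul_smul_comm, map_nsmul,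
    interiorProduct_pow_mul_of_mem_exteriorPower_two w hy, hwz, mul_zero, add_zero,
    ← mul_assoc (interiorProduct R V w y), hzc.eq, mul_comm m n, mul_smul]
  simp only [mul_assoc]

end InteriorProduct

/-- Let `y`, `z` be alternating 2-forms on a finite-dimensional real vector space `V` and let
`v, w ∈ V` satisfy `ι_v y = 0` and `ι_w z = 0`.  If `y⁴ + y²∧z² + z⁴ = 0` and
`y³∧z + y∧z³ = 0` in the exterior algebra, then `ι_w (ι_v (y²∧z³ − y∧z⁴)) = 0`. -/
theorem contraction_of_top_form_vanishes (V : Type*) [AddCommGroup V] [Module ℝ V]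
    [FiniteDimensional ℝ V] (y z : ExteriorAlgebra ℝ (Module.Dual ℝ V))
    (hy : y ∈ ⋀[ℝ]^2 (Module.Dual ℝ V)) (hz : z ∈ ⋀[ℝ]^2 (Module.Dual ℝ V))
    (v w : V)
    (hv : interiorProduct ℝ V v y = 0) (hw : interiorProduct ℝ V w z = 0)
    (h1 : y ^ 4 + y ^ 2 * z ^ 2 + z ^ 4 = 0)
    (h2 : y ^ 3 * z + y * z ^ 3 = 0) :
    interiorProduct ℝ V w (interiorProduct ℝ V v (y ^ 2 * z ^ 3 - y * z ^ 4)) = 0 := by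
  have key := interiorProduct_interiorProduct_pow_mul_pow hy hz hv hw
  have hzy : Commute z y := ExteriorAlgebra.commute_of_mem_exteriorPower_two hz y
  generalize interiorProduct ℝ V w y * interiorProduct ℝ V v z = c at key
  have cancel {n : ℕ} (hn : n ≠ 0) {t : ExteriorAlgebra ℝ (Module.Dual ℝ V)} (h : n • t = 0) :
      t = 0 := by
    rw [← Nat.cast_smul_eq_nsmul ℝ] at h
    exact (smul_eq_zero.mp h).resolve_left (Nat.cast_ne_zero.mpr hn)
  have hyz : y * z * c = 0 := by
    have h := congrArg (fun t => interiorProduct ℝ V w (interiorProduct ℝ V v t)) h1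
    have h40 := key 4 0
    have h22 := key 2 2
    have h04 := key 0 4
    simp only [pow_zero, mul_one, one_mul, mul_zero, zero_mul, zero_smul] at h40 h04
    simp only [map_add, map_zero, h40, h22, h04, zero_add, add_zero] at h
    simpa only [Nat.reduceSub, pow_one] using cancel (by norm_num) h
  have hsq : y ^ 2 * c + z ^ 2 * c = 0 := by
    have h := congrArg (fun t => interiorProduct ℝ V w (interiorProduct ℝ V v t)) h2
    have h31 := key 3 1
    have h13 := key 1 3
    simp only [pow_one] at h31 h13
    simp only [map_add, map_zero, h31, h13, mul_one, one_mul, ← smul_add] at h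
    simpa only [Nat.reduceSub, pow_zero, mul_one, one_mul] using cancel (by norm_num) h
  have hyzz : y * z ^ 2 * c = 0 := by
    rw [sq, ← mul_assoc, ← (hzy.mul_right (Commute.refl z)).eq, mul_assoc z, hyz, mul_zero]
  have hzzz : z ^ 3 * c = 0 := by
    have h := congrArg (z * ·) hsq
    have hyyz : z * (y ^ 2 * c) = 0 := by
      rw [← mul_assoc, (hzy.pow_right 2).eq, sq, mul_assoc y, mul_assoc, hyz, mul_zero]
    simpa only [mul_add, hyyz, zero_add, mul_zero, ← mul_assoc, ← pow_succ'] using h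
  have h23 := key 2 3
  have h14 := key 1 4
  simp only [pow_one] at h14
  rw [map_sub, map_sub, h23, h14]
  simp [hyzz, hzzz]
end

section
/- Let n ≥ 2 and let V be a real vector space of dimension n² + n. Suppose x₁, …, xₙ are alternating 2-forms on V which satisfy, for every 1 ≤ p ≤ n, the relation Σ x_{n-p+1}^{i_p} ∧ x_{n-p+2}^{i_{p-1}} ∧ ⋯ ∧ x_{n-1}^{i_2} ∧ x_n^{i_1} = 0, where the sum runs over all p-tuples (i₁,…,i_p) of nonnegative integers with i₁ + ⋯ + i_p = n − p + 2 and all powers are wedge powers in the exterior algebra. Then x₁ ∧ x₂² ∧ ⋯ ∧ xₙⁿ = 0. -/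
set_option synthInstance.maxHeartbeats 1000000
set_option maxHeartbeats 1000000

section TwoForms

open ExteriorAlgebra CliffordAlgebra

variable {K M N : Type*} [Field K] [AddCommGroup M] [Module K M] [AddCommGroup N] [Module K N]

theorem ExteriorAlgebra.two_form_induction {C : ExteriorAlgebra K M → Prop}
    {x : ExteriorAlgebra K M} (hx : x ∈ ⋀[K]^2 M)
    (ι_mul_ι : ∀ a b, C (ExteriorAlgebra.ι K a * ExteriorAlgebra.ι K b))
    (add : ∀ x y, C x → C y → C (x + y)) : C x := by
  rw [exteriorPower, pow_two] at hx
  refine Submodule.mul_induction_on hx ?_ add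
  rintro _ ⟨a, rfl⟩ _ ⟨b, rfl⟩
  exact ι_mul_ι a b

theorem ExteriorAlgebra.ι_mul_ι_eq_neg (a b : M) :
    ExteriorAlgebra.ι K a * ExteriorAlgebra.ι K b =
      -(ExteriorAlgebra.ι K b * ExteriorAlgebra.ι K a) :=
  eq_neg_of_add_eq_zero_left (ι_add_mul_swap a b)

theorem ExteriorAlgebra.commute_of_two_form {x : ExteriorAlgebra K M} (hx : x ∈ ⋀[K]^2 M)
    (y : ExteriorAlgebra K M) : Commute x y := by
  refine two_form_induction (C := fun x => Commute x y) hx (fun a b => ?_)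
    fun x x' hx hx' => hx.add_left hx'
  induction y using ExteriorAlgebra.induction with
  | algebraMap r => exact (Algebra.commutes r _).symm
  | ι m =>
    rw [commute_iff_eq, mul_assoc, ι_mul_ι_eq_neg b m, mul_neg, ← mul_assoc,
      ι_mul_ι_eq_neg a m, neg_mul, neg_neg, mul_assoc]
  | mul y z hy hz => exact hy.mul_right hz
  | add y z hy hz => exact hy.add_right hz

theorem ExteriorAlgebra.map_mem_two_form (f : M →ₗ[K] N) {x : ExteriorAlgebra K M}
    (hx : x ∈ ⋀[K]^2 M) : ExteriorAlgebra.map f x ∈ ⋀[K]^2 N := by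
  refine two_form_induction (C := fun x => ExteriorAlgebra.map f x ∈ ⋀[K]^2 N) hx
    (fun a b => ?_) fun x y hx hy => by rw [map_add]; exact add_mem hx hy
  rw [map_mul, ExteriorAlgebra.map_apply_ι, ExteriorAlgebra.map_apply_ι, exteriorPower, pow_two]
  exact Submodule.mul_mem_mul ⟨_, rfl⟩ ⟨_, rfl⟩

/-- The interior product of an element of the exterior algebra with a covector. -/
noncomputable abbrev ExteriorAlgebra.contract (d : Module.Dual K M) :
    ExteriorAlgebra K M →ₗ[K] ExteriorAlgebra K M :=
  contractLeft (Q := (0 : QuadraticForm K M)) d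

theorem ExteriorAlgebra.contract_ι_mul_ι (d : Module.Dual K M) (a b : M) :
    contract d (ExteriorAlgebra.ι K a * ExteriorAlgebra.ι K b) =
      ExteriorAlgebra.ι K (d a • b - d b • a) := by
  rw [contract, contractLeft_ι_mul, contractLeft_ι, ← Algebra.commutes, ← Algebra.smul_def,
    map_sub, map_smul, map_smul]

theorem ExteriorAlgebra.contract_two_form_mul (d : Module.Dual K M) {x : ExteriorAlgebra K M}
    (hx : x ∈ ⋀[K]^2 M) (y : ExteriorAlgebra K M) :
    contract d (x * y) = contract d x * y + x * contract d y := by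
  refine two_form_induction (C := fun x => contract d (x * y) =
    contract d x * y + x * contract d y) hx (fun a b => ?_) fun x x' hx hx' => ?_
  · rw [contract_ι_mul_ι, contract, mul_assoc, contractLeft_ι_mul, contractLeft_ι_mul]
    simp only [map_sub, map_smul, sub_mul, mul_sub, smul_mul_assoc, mul_smul_comm, mul_assoc]
    abel
  · rw [add_mul, map_add, hx, hx', map_add, add_mul, add_mul]
    abel

theorem ExteriorAlgebra.contract_two_form_pow (d : Module.Dual K M) {x : ExteriorAlgebra K M}
    (hx : x ∈ ⋀[K]^2 M) (k : ℕ) :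
    contract d (x ^ (k + 1)) = ((k : K) + 1) • (x ^ k * contract d x) := by
  induction k with
  | zero => simp
  | succ k ih =>
    rw [pow_succ' x (k + 1), contract_two_form_mul d hx, ih, mul_smul_comm, ← mul_assoc,
      ← pow_succ', ((commute_of_two_form hx _).pow_left (k + 1)).eq]
    push_cast
    module

theorem ExteriorAlgebra.exists_ι_eq_contract (d : Module.Dual K M) {x : ExteriorAlgebra K M}
    (hx : x ∈ ⋀[K]^2 M) : ∃ m, ExteriorAlgebra.ι K m = contract d x := by
  refine two_form_induction (C := fun x => ∃ m, ExteriorAlgebra.ι K m = contract d x) hx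
    (fun a b => ⟨_, (contract_ι_mul_ι d a b).symm⟩) ?_
  rintro x y ⟨a, ha⟩ ⟨b, hb⟩
  exact ⟨a + b, by rw [map_add, map_add, ha, hb]⟩

theorem ExteriorAlgebra.contract_map (f : M →ₗ[K] N) (d : Module.Dual K N)
    {x : ExteriorAlgebra K M} (hx : x ∈ ⋀[K]^2 M) :
    contract d (ExteriorAlgebra.map f x) = ExteriorAlgebra.map f (contract (d ∘ₗ f) x) := by
  refine two_form_induction (C := fun x => contract d (ExteriorAlgebra.map f x) =
    ExteriorAlgebra.map f (contract (d ∘ₗ f) x)) hx (fun a b => ?_) fun x y hx hy => ?_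
  · rw [map_mul, ExteriorAlgebra.map_apply_ι, ExteriorAlgebra.map_apply_ι, contract_ι_mul_ι,
      contract_ι_mul_ι, ExteriorAlgebra.map_apply_ι]
    simp
  · simp only [map_add, hx, hy]

theorem ExteriorAlgebra.sum_ι_mul_contract {I : Type*} [Fintype I] (e : Module.Basis I K M)
    {x : ExteriorAlgebra K M} (hx : x ∈ ⋀[K]^2 M) :
    ∑ i, ExteriorAlgebra.ι K (e i) * contract (e.coord i) x = (2 : K) • x := by
  refine two_form_induction (C := fun x => ∑ i, ExteriorAlgebra.ι K (e i) *
    contract (e.coord i) x = (2 : K) • x) hx (fun a b => ?_) fun x y hx hy => ?_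
  · have h (m : M) : ExteriorAlgebra.ι K m = ∑ i, e.coord i m • ExteriorAlgebra.ι K (e i) := by
      conv_lhs => rw [← e.sum_repr m]
      simp only [map_sum, map_smul, Module.Basis.coord_apply]
    calc _ = (∑ i, e.coord i a • ExteriorAlgebra.ι K (e i)) * ExteriorAlgebra.ι K b -
          (∑ i, e.coord i b • ExteriorAlgebra.ι K (e i)) * ExteriorAlgebra.ι K a := by
          rw [Finset.sum_mul, Finset.sum_mul, ← Finset.sum_sub_distrib]
          refine Finset.sum_congr rfl fun i _ => ?_
          rw [contract_ι_mul_ι, map_sub, map_smul, map_smul, mul_sub, mul_smul_comm,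
            mul_smul_comm, smul_mul_assoc, smul_mul_assoc]
      _ = _ := by
        rw [← h, ← h, ι_mul_ι_eq_neg b a, sub_neg_eq_add, two_smul]
  · simp only [map_add, mul_add, Finset.sum_add_distrib, hx, hy, smul_add]

theorem ExteriorAlgebra.mul_eq_zero_of_map_mkQ_eq_zero {W : Submodule K M}
    {ω : ExteriorAlgebra K M} (hω : ∀ y, Commute ω y)
    (hW : ∀ w ∈ W, ω * ExteriorAlgebra.ι K w = 0) {y : ExteriorAlgebra K M}
    (hy : ExteriorAlgebra.map W.mkQ y = 0) : ω * y = 0 := by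
  obtain ⟨s, hs⟩ := W.mkQ.exists_rightInverse_of_surjective W.range_mkQ
  suffices h : ∀ y, ω * y = ω * ExteriorAlgebra.map s (ExteriorAlgebra.map W.mkQ y) by
    rw [h, hy, map_zero, mul_zero]
  clear hy y
  intro y
  induction y using ExteriorAlgebra.induction with
  | algebraMap r => simp only [AlgHom.commutes]
  | ι m =>
    rw [ExteriorAlgebra.map_apply_ι, ExteriorAlgebra.map_apply_ι, ← sub_eq_zero, ← mul_sub,
      ← map_sub]
    refine hW _ ?_
    rw [← Submodule.Quotient.eq]
    exact (LinearMap.congr_fun hs (W.mkQ m)).symm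
  | mul y z hy hz =>
    rw [map_mul, map_mul, ← mul_assoc, hy, (hω _).eq, mul_assoc, hz, ← mul_assoc, ← (hω _).eq,
      mul_assoc]
  | add y z hy hz => rw [map_add, map_add, mul_add, mul_add, hy, hz]

/-- The vectors annihilated by left multiplication with a given element. -/
noncomputable def ExteriorAlgebra.annihilatedVectors (ω : ExteriorAlgebra K M) : Submodule K M :=
  LinearMap.ker (LinearMap.mulLeft K ω ∘ₗ ExteriorAlgebra.ι K)

theorem ExteriorAlgebra.mem_annihilatedVectors {ω : ExteriorAlgebra K M} {m : M} :
    m ∈ annihilatedVectors ω ↔ ω * ExteriorAlgebra.ι K m = 0 := Iff.rfl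

variable [CharZero K]

theorem ExteriorAlgebra.mem_annihilatedVectors_of_pow_eq_zero {x : ExteriorAlgebra K M}
    (hx : x ∈ ⋀[K]^2 M) {k : ℕ} (hk : x ^ (k + 1) = 0) {d : Module.Dual K M} {m : M}
    (hm : ExteriorAlgebra.ι K m = contract d x) : m ∈ annihilatedVectors (x ^ k) := by
  have h := contract_two_form_pow d hx k
  rw [hk, map_zero] at h
  rw [mem_annihilatedVectors, hm]
  exact (smul_eq_zero.mp h.symm).resolve_left (Nat.cast_add_one_ne_zero k)

variable [FiniteDimensional K M]

theorem ExteriorAlgebra.map_mkQ_eq_zero {W : Submodule K M} {x : ExteriorAlgebra K M}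
    (hx : x ∈ ⋀[K]^2 M)
    (h : ∀ d ∈ W.dualAnnihilator, ∀ m, ExteriorAlgebra.ι K m = contract d x → m ∈ W) :
    ExteriorAlgebra.map W.mkQ x = 0 := by
  have h2 := sum_ι_mul_contract (Module.finBasis K (M ⧸ W)) (map_mem_two_form W.mkQ hx)
  rw [Finset.sum_eq_zero] at h2
  · exact (smul_eq_zero.mp h2.symm).resolve_left two_ne_zero
  intro i _
  rw [contract_map W.mkQ _ hx]
  obtain ⟨m, hm⟩ := exists_ι_eq_contract ((Module.finBasis K (M ⧸ W)).coord i ∘ₗ W.mkQ) hx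
  have hmW := h _ ((Submodule.mem_dualAnnihilator _).mpr fun w hw => by
    rw [LinearMap.comp_apply, Submodule.mkQ_apply, (Submodule.Quotient.mk_eq_zero W).mpr hw,
      map_zero]) m hm
  rw [← hm, ExteriorAlgebra.map_apply_ι, Submodule.mkQ_apply,
    (Submodule.Quotient.mk_eq_zero W).mpr hmW, map_zero, mul_zero]

theorem ExteriorAlgebra.mul_sq_eq_zero_of_relations {x y : ExteriorAlgebra K M}
    (hx : x ∈ ⋀[K]^2 M) (hy : y ∈ ⋀[K]^2 M) (hy3 : y ^ 3 = 0)
    (hxy : x ^ 2 + x * y + y ^ 2 = 0) : x * y ^ 2 = 0 := by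
  set W := annihilatedVectors (y ^ 2)
  have hc : ∀ z, Commute (y ^ 2) z := fun z => (commute_of_two_form hy z).pow_left 2
  by_cases hd : ∀ d ∈ W.dualAnnihilator, ∀ m, ExteriorAlgebra.ι K m = contract d x → m ∈ W
  · rw [← (hc x).eq]
    exact mul_eq_zero_of_map_mkQ_eq_zero hc (fun w hw => hw) (map_mkQ_eq_zero hx hd)
  push Not at hd
  obtain ⟨d, hdW, a, ha, haW⟩ := hd
  obtain ⟨d', hd'a, hd'W⟩ := Submodule.exists_dual_map_eq_bot_of_notMem haW inferInstance
  have contract_y : contract d y = 0 := by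
    obtain ⟨m, hm⟩ := exists_ι_eq_contract d hy
    rw [← hm, ι_eq_zero_iff, ← Module.forall_dual_apply_eq_zero_iff K]
    intro f
    obtain ⟨m', hm'⟩ := exists_ι_eq_contract f hy
    have h := contractLeft_comm (Q := (0 : QuadraticForm K M)) (d := f) (d' := d) y
    change contract f (contract d y) = -contract d (contract f y) at h
    rw [← hm, ← hm', contract, contract, contractLeft_ι, contractLeft_ι,
      (Submodule.mem_dualAnnihilator _).mp hdW m'
        (mem_annihilatedVectors_of_pow_eq_zero hy hy3 hm'), map_zero, neg_zero] at h
    exact (ExteriorAlgebra.algebraMap_eq_zero_iff M _).mp h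
  set z := (2 : K) • x + y with hz
  have hzm : z ∈ ⋀[K]^2 M := add_mem (Submodule.smul_mem _ _ hx) hy
  have hza : z * ExteriorAlgebra.ι K a = 0 := by
    have h := congrArg (contract d) hxy
    rw [map_add, map_add, contract_two_form_pow d hx 1, contract_two_form_pow d hy 1,
      contract_two_form_mul d hx, contract_y, ← ha, ← (commute_of_two_form hy _).eq] at h
    rw [hz, add_mul, smul_mul_assoc, ← (contract d).map_zero, ← h]
    norm_num
  have hzz : z ^ 2 = 0 := by
    have h := congrArg (contract d') hza
    obtain ⟨b, hb⟩ := exists_ι_eq_contract d' hzm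
    rw [contract_two_form_mul d' hzm, map_zero, contract, contractLeft_ι,
      ← Algebra.commutes, ← Algebra.smul_def] at h
    have h' := congrArg (z * ·) h
    simp only [mul_add, mul_smul_comm, mul_zero] at h'
    rw [← mul_assoc, (commute_of_two_form hzm _).eq, mul_assoc, hza, mul_zero, zero_add,
      ← pow_two] at h'
    exact (smul_eq_zero.mp h').resolve_left hd'a
  have h3 : (3 : K) • y ^ 2 = (4 : K) • (x ^ 2 + x * y + y ^ 2) - z ^ 2 := by
    rw [hz, pow_two, pow_two, pow_two]
    simp only [add_mul, mul_add, smul_mul_assoc, mul_smul_comm,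
      ← (commute_of_two_form hx y).eq]
    module
  rw [hxy, hzz, smul_zero, sub_zero] at h3
  rw [(smul_eq_zero.mp h3).resolve_left three_ne_zero, mul_zero]

end TwoForms

theorem Finset.Nat.sum_antidiagonalTuple_prod_of_last_eq_zero {A : Type*} [Semiring A] (p k : ℕ)
    (y : Fin (p + 1) → A) (hy : y (Fin.last p) = 0) :
    ∑ c ∈ Finset.Nat.antidiagonalTuple (p + 1) k, (List.ofFn fun t => y t ^ c t).prod =
      ∑ c ∈ Finset.Nat.antidiagonalTuple p k,
        (List.ofFn fun t : Fin p => y t.castSucc ^ c t).prod := by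
  symm
  refine Finset.sum_of_injOn (fun c => Fin.snoc (α := fun _ => ℕ) c 0) ?_ ?_ ?_ ?_
  · intro c _ c' _ h
    exact (Fin.snoc_injective2 h).1
  · intro c hc
    simp only [Finset.mem_coe, Finset.Nat.mem_antidiagonalTuple] at hc ⊢
    simpa [Fin.sum_univ_castSucc] using hc
  · intro c hc hc'
    rw [List.ofFn_succ', List.concat_eq_append, List.prod_append, List.prod_singleton, hy,
      zero_pow, mul_zero]
    intro h0
    refine hc' ⟨Fin.init c, ?_, ?_⟩
    · simp only [Finset.mem_coe, Finset.Nat.mem_antidiagonalTuple] at hc ⊢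
      rw [Fin.sum_univ_castSucc, h0, add_zero] at hc
      exact hc
    · simp only [← h0, Fin.snoc_init_self]
  · intro c _
    rw [List.ofFn_succ', List.concat_eq_append, List.prod_append]
    simp

theorem ExteriorAlgebra.prod_pow_eq_zero_of_relations {K : Type*} [Field K] [CharZero K] (n : ℕ)
    (hn : 2 ≤ n) (M : Type*) [AddCommGroup M] [Module K M] [FiniteDimensional K M]
    (x : ℕ → ExteriorAlgebra K M) (hx : ∀ i < n, x i ∈ ⋀[K]^2 M)
    (hrel : ∀ p, 1 ≤ p → p ≤ n → ∑ c ∈ Finset.Nat.antidiagonalTuple p (n - p + 2),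
      (List.ofFn fun t : Fin p => x (n - p + t.val) ^ c t).prod = 0) :
    (List.ofFn fun i : Fin n => x i ^ (i.val + 1)).prod = 0 := by
  induction n, hn using Nat.le_induction generalizing M with
  | base =>
    have h1 := hrel 1 le_rfl one_le_two
    have h2 := hrel 2 one_le_two le_rfl
    simp [Finset.Nat.antidiagonalTuple_two, Finset.Nat.antidiagonal_succ] at h1 h2
    simpa [List.ofFn_succ] using mul_sq_eq_zero_of_relations (hx 0 two_pos) (hx 1 one_lt_two) h1
      (by rw [← h2]; abel)
  | succ n hn ih =>
    have hxn := hx n n.lt_succ_self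
    have hpow : x n ^ (n + 1 + 1) = 0 := by
      simpa using hrel 1 le_rfl (by lia)
    set W := annihilatedVectors (x n ^ (n + 1))
    have hmap : ExteriorAlgebra.map W.mkQ (x n) = 0 :=
      map_mkQ_eq_zero hxn fun d _ m hm => mem_annihilatedVectors_of_pow_eq_zero hxn hpow hm
    have key := ih (M ⧸ W) (fun i => ExteriorAlgebra.map W.mkQ (x i))
      (fun i hi => map_mem_two_form _ (hx i (by lia))) fun p hp1 hp2 => by
        have h := congrArg (ExteriorAlgebra.map W.mkQ) (hrel (p + 1) (by lia) (by lia))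
        simp only [map_sum, map_list_prod, List.map_ofFn, Function.comp_def, map_pow, map_zero,
          Nat.add_sub_add_right] at h
        rw [Finset.Nat.sum_antidiagonalTuple_prod_of_last_eq_zero p (n - p + 2)
          (fun t => ExteriorAlgebra.map W.mkQ (x (n - p + t.val)))] at h
        · exact h
        · simpa [Nat.sub_add_cancel hp2] using hmap
    have hc : ∀ z, Commute (x n ^ (n + 1)) z :=
      fun z => (commute_of_two_form hxn z).pow_left (n + 1)
    rw [List.ofFn_succ', List.concat_eq_append, List.prod_append, List.prod_singleton,
      Fin.val_last, ← (hc _).eq]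
    refine mul_eq_zero_of_map_mkQ_eq_zero (W := W) hc (fun w hw => hw) ?_
    rw [map_list_prod, List.map_ofFn]
    simpa [Function.comp_def] using key

/-- Kotschick–Terzić lemma for `SU(n+1)/Tⁿ`, pointwise form: if `x₁, …, xₙ` are alternating
2-forms on a real vector space of dimension `n² + n` (`n ≥ 2`) satisfying, for each
`1 ≤ p ≤ n`, the relations
`Σ_{i₁+⋯+i_p = n−p+2} x_{n−p+1}^{i_p} ∧ ⋯ ∧ x_n^{i_1} = 0`,
then `x₁ ∧ x₂² ∧ ⋯ ∧ xₙⁿ = 0`. -/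
theorem volume_form_vanishes_A (n : ℕ) (hn : 2 ≤ n) (V : Type*) [AddCommGroup V]
    [Module ℝ V] [FiniteDimensional ℝ V] (hdim : Module.finrank ℝ V = n ^ 2 + n)
    (x : Fin n → ExteriorAlgebra ℝ (Module.Dual ℝ V))
    (hx : ∀ i, x i ∈ ⋀[ℝ]^2 (Module.Dual ℝ V))
    (hrel : ∀ p : ℕ, ∀ _hp1 : 1 ≤ p, ∀ hp2 : p ≤ n,
      ∑ c ∈ Finset.Nat.antidiagonalTuple p (n - p + 2),
        (List.ofFn fun t : Fin p =>
          x ⟨n - p + t.val, by have := t.isLt; omega⟩ ^ c t).prod = 0) :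
    (List.ofFn fun i : Fin n => x i ^ (i.val + 1)).prod = 0 := by
  have key := ExteriorAlgebra.prod_pow_eq_zero_of_relations n hn (Module.Dual ℝ V)
    (fun i => if h : i < n then x ⟨i, h⟩ else 0)
    (fun i hi => by simpa [hi] using hx ⟨i, hi⟩) fun p hp1 hp2 => by
      rw [← hrel p hp1 hp2]
      refine Finset.sum_congr rfl fun c _ => ?_
      congr 2
      funext t
      rw [dif_pos]
  simpa using key
end

section
/- Let n ≥ 2 and let V be a real vector space of dimension 2n². Suppose x₁, …, xₙ are alternating 2-forms on V which satisfy, for every 1 ≤ p ≤ n, the relation Σ x_{n-p+1}^{2i_p} ∧ x_{n-p+2}^{2i_{p-1}} ∧ ⋯ ∧ x_{n-1}^{2i_2} ∧ x_n^{2i_1} = 0, where the sum runs over all p-tuples (i₁,…,i_p) of nonnegative integers with i₁ + ⋯ + i_p = n − p + 1 and all powers are wedge powers in the exterior algebra. Then x₁ ∧ x₂³ ∧ x₃⁵ ∧ ⋯ ∧ xₙ^{2n−1} = 0. -/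
set_option synthInstance.maxHeartbeats 1000000
set_option maxHeartbeats 1000000

namespace ExteriorAlgebra

section Contraction

variable {R M : Type*} [CommRing R] [AddCommGroup M] [Module R M]

/-- Left contraction of an element of the exterior algebra by a linear form. -/
noncomputable def contract_s5 (d : Module.Dual R M) : ExteriorAlgebra R M →ₗ[R] ExteriorAlgebra R M :=
  CliffordAlgebra.contractLeft (Q := (0 : QuadraticForm R M)) d

theorem contract_ι (d : Module.Dual R M) (a : M) :
    contract_s5 d (ι R a) = algebraMap R _ (d a) :=
  CliffordAlgebra.contractLeft_ι (0 : QuadraticForm R M) d a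

theorem contract_ι_mul (d : Module.Dual R M) (a : M) (z : ExteriorAlgebra R M) :
    contract_s5 d (ι R a * z) = d a • z - ι R a * contract_s5 d z :=
  CliffordAlgebra.contractLeft_ι_mul (Q := (0 : QuadraticForm R M)) d a z

theorem contract_algebraMap (d : Module.Dual R M) (r : R) :
    contract_s5 d (algebraMap R (ExteriorAlgebra R M) r) = 0 :=
  CliffordAlgebra.contractLeft_algebraMap (0 : QuadraticForm R M) d r

theorem contract_comm (d e : Module.Dual R M) (z : ExteriorAlgebra R M) :
    contract_s5 d (contract_s5 e z) = -contract_s5 e (contract_s5 d z) :=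
  CliffordAlgebra.contractLeft_comm (Q := (0 : QuadraticForm R M)) d e z

theorem contract_map_s5 {N : Type*} [AddCommGroup N] [Module R N] (f : M →ₗ[R] N)
    (d : Module.Dual R N) (z : ExteriorAlgebra R M) :
    contract_s5 d (map f z) = map f (contract_s5 (d ∘ₗ f) z) := by
  induction z using CliffordAlgebra.left_induction with
  | algebraMap r =>
    have h : map f (algebraMap R (ExteriorAlgebra R M) r) = algebraMap R _ r :=
      AlgHom.commutes _ _
    exact (congrArg _ h).trans
      ((contract_algebraMap d r).trans
        (by rw [← map_zero (map f), ← contract_algebraMap (d ∘ₗ f) r]))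
  | add a b ha hb => simp only [map_add, ha, hb]
  | ι_mul a m ha =>
    have h : contract_s5 d (map f (ι R m * a)) = map f (contract_s5 (d ∘ₗ f) (ι R m * a)) := by
      rw [map_mul, map_apply_ι, contract_ι_mul, contract_ι_mul, ha, map_sub, map_smul, map_mul,
        map_apply_ι, LinearMap.comp_apply]
    exact h

theorem ι_mul_ι_mem_exteriorPower_two (a b : M) : ι R a * ι R b ∈ ⋀[R]^2 M := by
  rw [exteriorPower, pow_two]
  exact Submodule.mul_mem_mul ⟨a, rfl⟩ ⟨b, rfl⟩

theorem exteriorPower_two_induction {C : ∀ x : ExteriorAlgebra R M, x ∈ ⋀[R]^2 M → Prop}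
    (ι_mul_ι : ∀ a b : M, C (ι R a * ι R b) (ι_mul_ι_mem_exteriorPower_two a b))
    (add : ∀ y z hy hz, C y hy → C z hz → C (y + z) (add_mem hy hz))
    {x : ExteriorAlgebra R M} (hx : x ∈ ⋀[R]^2 M) : C x hx := by
  have hx' := hx
  rw [exteriorPower, pow_two] at hx'
  suffices h : ∃ h, C x h from h.2
  refine Submodule.mul_induction_on hx' ?_
    fun y z ⟨hy, hCy⟩ ⟨hz, hCz⟩ => ⟨_, add y z hy hz hCy hCz⟩
  rintro _ ⟨a, rfl⟩ _ ⟨b, rfl⟩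
  exact ⟨_, ι_mul_ι a b⟩

theorem commute_of_mem_exteriorPower_two_s5 {x : ExteriorAlgebra R M} (hx : x ∈ ⋀[R]^2 M)
    (z : ExteriorAlgebra R M) : Commute x z := by
  induction hx using exteriorPower_two_induction with
  | add _ _ _ _ hy hz => exact hy.add_left hz
  | ι_mul_ι a b =>
    induction z using ExteriorAlgebra.induction with
    | algebraMap r => exact (Algebra.commutes r _).symm
    | add _ _ hy hz => exact hy.add_right hz
    | mul _ _ hy hz => exact hy.mul_right hz
    | ι c =>
      have hbc := eq_neg_of_add_eq_zero_left (ι_add_mul_swap (R := R) b c)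
      have hac := eq_neg_of_add_eq_zero_left (ι_add_mul_swap (R := R) a c)
      rw [Commute, SemiconjBy, mul_assoc, hbc, mul_neg, ← mul_assoc, hac, neg_mul, neg_neg,
        mul_assoc]

theorem exists_contract_eq_ι {x : ExteriorAlgebra R M} (hx : x ∈ ⋀[R]^2 M)
    (d : Module.Dual R M) : ∃ u, contract_s5 d x = ι R u := by
  induction hx using exteriorPower_two_induction with
  | add _ _ _ _ hy hz =>
    obtain ⟨u, hu⟩ := hy
    obtain ⟨v, hv⟩ := hz
    exact ⟨u + v, by rw [map_add, map_add, hu, hv]⟩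
  | ι_mul_ι a b =>
    refine ⟨d a • b - d b • a, ?_⟩
    rw [contract_ι_mul, contract_ι, ← Algebra.commutes, ← Algebra.smul_def, map_sub, map_smul,
      map_smul]

theorem contract_mul_of_mem_exteriorPower_two {x : ExteriorAlgebra R M} (hx : x ∈ ⋀[R]^2 M)
    (d : Module.Dual R M) (z : ExteriorAlgebra R M) :
    contract_s5 d (x * z) = contract_s5 d x * z + x * contract_s5 d z := by
  induction hx using exteriorPower_two_induction with
  | add _ _ _ _ hy hz => simp only [add_mul, map_add, hy, hz]; abel
  | ι_mul_ι a b =>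
    rw [mul_assoc, contract_ι_mul, contract_ι_mul, contract_ι_mul, contract_ι,
      ← Algebra.commutes, ← Algebra.smul_def]
    simp only [mul_sub, sub_mul, smul_mul_assoc, mul_smul_comm, mul_assoc]
    abel

theorem contract_pow_succ {x : ExteriorAlgebra R M} (hx : x ∈ ⋀[R]^2 M)
    (d : Module.Dual R M) (m : ℕ) :
    contract_s5 d (x ^ (m + 1)) = (m + 1) • (contract_s5 d x * x ^ m) := by
  induction m with
  | zero => simp
  | succ m ih =>
    have h : x * (contract_s5 d x * x ^ m) = contract_s5 d x * x ^ (m + 1) := by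
      rw [← mul_assoc, (commute_of_mem_exteriorPower_two_s5 hx _).eq, mul_assoc, ← pow_succ']
    rw [pow_succ' x (m + 1), contract_mul_of_mem_exteriorPower_two hx, ih, mul_smul_comm, h,
      succ_nsmul _ (m + 1), add_comm]

theorem map_mem_exteriorPower_two {N : Type*} [AddCommGroup N] [Module R N] (f : M →ₗ[R] N)
    {x : ExteriorAlgebra R M} (hx : x ∈ ⋀[R]^2 M) : map f x ∈ ⋀[R]^2 N := by
  induction hx using exteriorPower_two_induction with
  | add _ _ _ _ hy hz => rw [map_add]; exact add_mem hy hz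
  | ι_mul_ι a b =>
    rw [map_mul, map_apply_ι, map_apply_ι]
    exact ι_mul_ι_mem_exteriorPower_two _ _

theorem sum_ι_mul_contract_coord {I : Type*} [Fintype I] (b : Module.Basis I R M)
    {x : ExteriorAlgebra R M} (hx : x ∈ ⋀[R]^2 M) :
    ∑ i, ι R (b i) * contract_s5 (b.coord i) x = 2 • x := by
  induction hx using exteriorPower_two_induction with
  | add _ _ _ _ hy hz => simp only [map_add, mul_add, Finset.sum_add_distrib, hy, hz, smul_add]
  | ι_mul_ι v w =>
    have h : ∀ i, ι R (b i) * contract_s5 (b.coord i) (ι R v * ι R w) =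
        ι R (b.repr v i • b i) * ι R w - ι R (b.repr w i • b i) * ι R v := fun i => by
      rw [contract_ι_mul, contract_ι, ← Algebra.commutes, ← Algebra.smul_def]
      simp only [mul_sub, map_smul, smul_mul_assoc, mul_smul_comm, Module.Basis.coord_apply]
    simp only [h, Finset.sum_sub_distrib, ← Finset.sum_mul, ← map_sum, b.sum_repr]
    rw [eq_neg_of_add_eq_zero_left (ι_add_mul_swap (R := R) w v), two_smul, sub_neg_eq_add]

end Contraction

section Field

variable {K W : Type*} [Field K] [AddCommGroup W] [Module K W]

theorem eq_zero_of_contract_ι_eq_zero {w : W}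
    (h : ∀ d : Module.Dual K W, contract_s5 d (ι K w) = 0) : w = 0 := by
  refine (Module.forall_dual_apply_eq_zero_iff K w).1 fun d => ?_
  have hd := h d
  rwa [contract_ι, algebraMap_eq_zero_iff] at hd

theorem contract_comp_eq_zero {x : ExteriorAlgebra K W} (hx : x ∈ ⋀[K]^2 W)
    {p : W →ₗ[K] W} (hp : ∀ d, map p (contract_s5 d x) = 0) (d : Module.Dual K W) :
    contract_s5 (d ∘ₗ p) x = 0 := by
  obtain ⟨w, hw⟩ := exists_contract_eq_ι hx (d ∘ₗ p)
  have hw0 : w = 0 := eq_zero_of_contract_ι_eq_zero fun e => by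
    obtain ⟨u, hu⟩ := exists_contract_eq_ι hx e
    have hpu : p u = 0 := by
      have h := hp e
      rwa [hu, map_apply_ι, ι_eq_zero_iff] at h
    rw [← hw, contract_comm, hu, contract_ι, LinearMap.comp_apply, hpu, map_zero, map_zero,
      neg_zero]
  rw [hw, hw0, map_zero]

variable [CharZero K]

/-- If `x ^ (m + 1) = 0`, there is a linear map whose induced endomorphism of the exterior algebra
kills all contractions of `x` but is invisible after multiplication by `x ^ m`. -/
theorem exists_map_mul_pow_eq {x : ExteriorAlgebra K W} (hx : x ∈ ⋀[K]^2 W) {m : ℕ}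
    (hm : x ^ (m + 1) = 0) :
    ∃ p : W →ₗ[K] W, (∀ d, map p (contract_s5 d x) = 0) ∧ ∀ z, map p z * x ^ m = z * x ^ m := by
  let U : Submodule K W :=
    LinearMap.ker ((LinearMap.mulRight K (x ^ m)) ∘ₗ (ι K : W →ₗ[K] ExteriorAlgebra K W))
  have hU : ∀ u, u ∈ U ↔ ι K u * x ^ m = 0 := fun u => Iff.rfl
  obtain ⟨g, hg⟩ := U.subtype.exists_leftInverse_of_injective U.ker_subtype
  have hgU : ∀ u ∈ U, (g u : W) = u := fun u hu =>
    congrArg Subtype.val (LinearMap.congr_fun hg ⟨u, hu⟩)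
  refine ⟨LinearMap.id - U.subtype ∘ₗ g, fun d => ?_, fun z => ?_⟩
  · obtain ⟨u, hu⟩ := exists_contract_eq_ι hx d
    have hcontract : contract_s5 d x * x ^ m = 0 := by
      have h := contract_pow_succ hx d m
      rw [hm, map_zero, ← Nat.cast_smul_eq_nsmul K] at h
      exact (smul_eq_zero.1 h.symm).resolve_left (Nat.cast_ne_zero.2 m.succ_ne_zero)
    have huU : u ∈ U := (hU u).2 (hu ▸ hcontract)
    rw [hu, map_apply_ι]
    simp [hgU u huU]
  · induction z using ExteriorAlgebra.induction with
    | algebraMap r => rw [AlgHom.commutes]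
    | add _ _ hy hz => rw [map_add, add_mul, add_mul, hy, hz]
    | mul a b ha hb =>
      have hc := (commute_of_mem_exteriorPower_two_s5 hx b).pow_left m
      rw [map_mul, mul_assoc, hb, ← hc.eq, ← mul_assoc, ha, mul_assoc, hc.eq, mul_assoc]
    | ι w =>
      have hw := (hU _).1 (g w).2
      rw [map_apply_ι, LinearMap.sub_apply, map_sub, sub_mul]
      simp [hw]

variable [FiniteDimensional K W]

theorem eq_zero_of_contract_eq_zero {x : ExteriorAlgebra K W} (hx : x ∈ ⋀[K]^2 W)
    (h : ∀ d : Module.Dual K W, contract_s5 d x = 0) : x = 0 := by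
  have hs := sum_ι_mul_contract_coord (Module.finBasis K W) hx
  simp only [h, mul_zero, Finset.sum_const_zero] at hs
  have h2 : (2 : K) • x = 0 := by rw [ofNat_smul_eq_nsmul, ← hs]
  exact (smul_eq_zero.1 h2).resolve_left two_ne_zero

theorem map_eq_zero_of_map_contract_eq_zero {x : ExteriorAlgebra K W} (hx : x ∈ ⋀[K]^2 W)
    {p : W →ₗ[K] W} (hp : ∀ d, map p (contract_s5 d x) = 0) : map p x = 0 :=
  eq_zero_of_contract_eq_zero (map_mem_exteriorPower_two p hx) fun d => by
    rw [contract_map_s5, hp]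

/-- The case of two forms: `y⁴ = 0` and `x² + y² = 0` imply `x ∧ y³ = 0`. -/
theorem mul_pow_three_eq_zero {x y : ExteriorAlgebra K W} (hx : x ∈ ⋀[K]^2 W)
    (hy : y ∈ ⋀[K]^2 W) (hy4 : y ^ 4 = 0) (hxy : x ^ 2 + y ^ 2 = 0) : x * y ^ 3 = 0 := by
  obtain ⟨p, hp, hpy⟩ := exists_map_mul_pow_eq hy hy4
  by_cases hx2 : x ^ 2 = 0
  · have hy2 : y ^ 2 = 0 := by rwa [hx2, zero_add] at hxy
    rw [pow_succ, hy2, zero_mul, mul_zero]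
  have hmul : ∀ d : Module.Dual K W, contract_s5 (d ∘ₗ p) x * x = 0 := fun d => by
    have h := congrArg (contract_s5 (d ∘ₗ p)) hxy
    rw [map_add, map_zero, contract_pow_succ hx, contract_pow_succ hy,
      contract_comp_eq_zero hy hp, zero_mul, smul_zero, add_zero, pow_one,
      ← Nat.cast_smul_eq_nsmul K] at h
    exact (smul_eq_zero.1 h).resolve_left (Nat.cast_ne_zero.2 (by norm_num))
  have hpair : ∀ d e : Module.Dual K W, contract_s5 (e ∘ₗ p) (contract_s5 (d ∘ₗ p) x) = 0 := by
    intro d e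
    obtain ⟨u, hu⟩ := exists_contract_eq_ι hx (d ∘ₗ p)
    have h := congrArg (contract_s5 (e ∘ₗ p)) (hmul d)
    rw [hu, contract_ι_mul, map_zero, sub_eq_zero] at h
    rw [hu, contract_ι, algebraMap_eq_zero_iff]
    by_contra hne
    apply hx2
    have hz : (e ∘ₗ p) u • x ^ 2 = 0 := by
      rw [pow_two, ← smul_mul_assoc, h, mul_assoc, hmul, mul_zero]
    exact (smul_eq_zero.1 hz).resolve_left hne
  have hpx : map p x = 0 := by
    refine eq_zero_of_contract_eq_zero (map_mem_exteriorPower_two p hx) fun d => ?_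
    obtain ⟨w, hw⟩ := exists_contract_eq_ι (map_mem_exteriorPower_two p hx) d
    have hw0 : w = 0 := eq_zero_of_contract_ι_eq_zero fun e => by
      rw [← hw, contract_map_s5, contract_map_s5, hpair, map_zero]
    rw [hw, hw0, map_zero]
  rw [← hpy, hpx, zero_mul]

end Field

end ExteriorAlgebra

theorem List.prod_ofFn_succ' {A : Type*} [Monoid A] {n : ℕ} (f : Fin (n + 1) → A) :
    (List.ofFn f).prod = (List.ofFn fun i : Fin n => f i.castSucc).prod * f (Fin.last n) := by
  rw [List.ofFn_succ', List.prod_concat]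

/-- Setting the last variable to zero in a complete homogeneous symmetric polynomial in squares. -/
theorem Finset.Nat.sum_antidiagonalTuple_succ_of_last_eq_zero {A : Type*} [Semiring A]
    {p : ℕ} (k : ℕ) (y : Fin (p + 1) → A) (hy : y (Fin.last p) = 0) :
    ∑ c ∈ Finset.Nat.antidiagonalTuple (p + 1) k, (List.ofFn fun t => y t ^ (2 * c t)).prod =
      ∑ c ∈ Finset.Nat.antidiagonalTuple p k,
        (List.ofFn fun t : Fin p => y t.castSucc ^ (2 * c t)).prod := by
  symm
  refine Finset.sum_of_injOn (fun c => Fin.snoc (α := fun _ => ℕ) c 0) ?_ ?_ ?_ ?_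
  · intro c _ c' _ h
    exact (Fin.snoc_injective2 h).1
  · intro c hc
    simpa [Finset.Nat.mem_antidiagonalTuple, Fin.sum_univ_castSucc] using hc
  · intro c hc hnot
    have hlast : c (Fin.last p) ≠ 0 := by
      intro h0
      refine hnot ⟨Fin.init c, ?_, ?_⟩
      · simpa [Finset.Nat.mem_antidiagonalTuple, Fin.sum_univ_castSucc, h0, Fin.init] using hc
      · simpa only [h0] using Fin.snoc_init_self c
    rw [List.prod_ofFn_succ', hy, zero_pow (mul_ne_zero two_ne_zero hlast), mul_zero]
  · intro c _
    rw [List.prod_ofFn_succ']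
    simp

open ExteriorAlgebra in
/-- The vanishing holds over every field of characteristic zero and in every dimension. -/
theorem prod_odd_pow_eq_zero {K W : Type*} [Field K] [CharZero K] [AddCommGroup W] [Module K W]
    [FiniteDimensional K W] (n : ℕ) (hn : 2 ≤ n) (x : Fin n → ExteriorAlgebra K W)
    (hx : ∀ i, x i ∈ ⋀[K]^2 W)
    (hrel : ∀ p : ℕ, 1 ≤ p → ∀ hp2 : p ≤ n,
      ∑ c ∈ Finset.Nat.antidiagonalTuple p (n - p + 1),
        (List.ofFn fun t : Fin p =>
          x ⟨n - p + t.val, by have := t.isLt; omega⟩ ^ (2 * c t)).prod = 0) :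
    (List.ofFn fun i : Fin n => x i ^ (2 * i.val + 1)).prod = 0 := by
  induction n, hn using Nat.le_induction with
  | base =>
    have h1 := hrel 1 le_rfl one_le_two
    have h2 := hrel 2 one_le_two le_rfl
    have hy4 : x 1 ^ 4 = 0 := by
      simpa [Finset.Nat.antidiagonalTuple_one] using h1
    have hxy : x 0 ^ 2 + x 1 ^ 2 = 0 := by
      rw [add_comm]
      simpa [Finset.Nat.antidiagonalTuple_two, Finset.sum_map,
        Finset.Nat.sum_antidiagonal_succ] using h2
    simpa using mul_pow_three_eq_zero (hx 0) (hx 1) hy4 hxy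
  | succ n hn ih =>
    have hlast : x (Fin.last n) ^ (2 * n + 1 + 1) = 0 := by
      have h1 := hrel 1 le_rfl (by omega)
      simpa [Finset.Nat.antidiagonalTuple_one, Fin.last, mul_add] using h1
    obtain ⟨p, hp, hpz⟩ := exists_map_mul_pow_eq (hx (Fin.last n)) hlast
    have hpx := map_eq_zero_of_map_contract_eq_zero (hx (Fin.last n)) hp
    have hzero := ih (fun i => map p (x i.castSucc))
      (fun i => map_mem_exteriorPower_two p (hx i.castSucc)) fun q hq hqn => by
        have h := congrArg (map p) (hrel (q + 1) (by omega) (by omega))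
        simp only [map_sum, map_list_prod, List.map_ofFn, Function.comp_def, map_pow,
          map_zero] at h
        rw [Finset.Nat.sum_antidiagonalTuple_succ_of_last_eq_zero _
          (fun t : Fin (q + 1) => map p (x ⟨n + 1 - (q + 1) + t.val, by omega⟩))] at h
        · simpa only [Nat.add_sub_add_right, Fin.val_castSucc, Fin.castSucc_mk] using h
        · rw [← hpx]
          congr 2
          ext
          simp only [Fin.val_last]
          omega
    rw [List.prod_ofFn_succ', Fin.val_last, ← hpz, map_list_prod, List.map_ofFn]
    simp only [Function.comp_def, map_pow, Fin.val_castSucc]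
    rw [hzero, zero_mul]

/-- Kotschick–Terzić lemma for `Spin(2n+1)/Tⁿ` and `Sp(n)/Tⁿ`, pointwise form: if
`x₁, …, xₙ` are alternating 2-forms on a real vector space of dimension `2n²` (`n ≥ 2`)
satisfying, for each `1 ≤ p ≤ n`, the relations
`Σ_{i₁+⋯+i_p = n−p+1} x_{n−p+1}^{2i_p} ∧ ⋯ ∧ x_n^{2i_1} = 0`,
then `x₁ ∧ x₂³ ∧ x₃⁵ ∧ ⋯ ∧ xₙ^{2n−1} = 0`. -/
theorem volume_form_vanishes_BC (n : ℕ) (hn : 2 ≤ n) (V : Type*) [AddCommGroup V]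
    [Module ℝ V] [FiniteDimensional ℝ V] (hdim : Module.finrank ℝ V = 2 * n ^ 2)
    (x : Fin n → ExteriorAlgebra ℝ (Module.Dual ℝ V))
    (hx : ∀ i, x i ∈ ⋀[ℝ]^2 (Module.Dual ℝ V))
    (hrel : ∀ p : ℕ, ∀ _hp1 : 1 ≤ p, ∀ hp2 : p ≤ n,
      ∑ c ∈ Finset.Nat.antidiagonalTuple p (n - p + 1),
        (List.ofFn fun t : Fin p =>
          x ⟨n - p + t.val, by have := t.isLt; omega⟩ ^ (2 * c t)).prod = 0) :
    (List.ofFn fun i : Fin n => x i ^ (2 * i.val + 1)).prod = 0 := by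
  exact prod_odd_pow_eq_zero n hn x hx hrel
end

section
/- In ℚ[x₁,…,x₇], let P be the product of the 14 linear forms x₁−x₂, x₁−x₃, x₁−x₄, x₁−x₅, x₁−x₆, x₁−x₇, x₂−x₄, x₂−x₅, x₂−x₆, x₂−x₇, x₃−x₄, x₃−x₅, x₃−x₆, x₃−x₇. Then P − 105·x₂x₃x₄³x₅³x₆³x₇³ belongs to the ideal generated by the power sums e₁,…,e₇, where e_k = x₁^k + ⋯ + x₇^k. Equivalently, in the quotient ring ℚ[x₁,…,x₇]/⟨e₁,…,e₇⟩ one has P = 105·x₂x₃x₄³x₅³x₆³x₇³. -/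
open MvPolynomial

/-- The ideal `⟨e₁,…,e₇⟩` of power sums in `ℚ[x₁,…,x₇]`. -/
noncomputable def powerSumIdeal7 : Ideal (MvPolynomial (Fin 7) ℚ) :=
  Ideal.span (Set.range fun k : Fin 7 => ∑ i, X i ^ (k.val + 1))

/-- In a `ℚ`-algebra, if the first `|σ|` power sums of a family indexed by `σ` vanish, then so do its
elementary symmetric functions of positive degree at most `|σ|`. -/
theorem aeval_esymm_eq_zero_of_sum_pow_eq_zero {σ A : Type*} [Fintype σ] [CommRing A]
    [Algebra ℚ A] (x : σ → A) (h : ∀ k, 0 < k → k ≤ Fintype.card σ → ∑ i, x i ^ k = 0)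
    {k : ℕ} (hk : 0 < k) (hk' : k ≤ Fintype.card σ) : aeval x (esymm σ ℚ k) = 0 := by
  have newton := congrArg (aeval x) (mul_esymm_eq_sum σ ℚ k)
  have vanish : ∑ a ∈ Finset.HasAntidiagonal.antidiagonal k with a.1 < k,
      aeval x ((-1) ^ a.1 * esymm σ ℚ a.1 * psum σ ℚ a.2) = 0 := by
    refine Finset.sum_eq_zero fun a ha => ?_
    simp only [Finset.mem_filter, Finset.HasAntidiagonal.mem_antidiagonal] at ha
    have : aeval x (psum σ ℚ a.2) = 0 := by
      simpa [psum] using h a.2 (by omega) (by omega)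
    rw [map_mul, this, mul_zero]
  rw [map_mul, map_mul, map_sum, vanish, mul_zero, map_natCast] at newton
  have unit : IsUnit (k : A) := by
    rw [← map_natCast (algebraMap ℚ A) k]
    exact (IsUnit.mk0 (k : ℚ) (by exact_mod_cast hk.ne')).map _
  exact unit.mul_right_eq_zero.mp newton

/-- In a `ℚ`-algebra, a family whose first `|σ|` power sums vanish has the characteristic polynomial
`T ^ |σ|`. -/
theorem prod_X_sub_C_eq_X_pow_of_sum_pow_eq_zero {σ A : Type*} [Fintype σ] [CommRing A]
    [Algebra ℚ A] (x : σ → A) (h : ∀ k, 0 < k → k ≤ Fintype.card σ → ∑ i, x i ^ k = 0) :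
    ∏ i, (Polynomial.X - Polynomial.C (x i)) = Polynomial.X ^ Fintype.card σ := by
  have vieta := Multiset.prod_X_sub_X_eq_sum_esymm (Finset.univ.val.map x)
  rw [Multiset.map_map, Finset.sum_range_succ', Finset.sum_eq_zero] at vieta
  · simpa [Multiset.esymm, Multiset.powersetCard_zero_left] using vieta
  · intro j hj
    rw [← aeval_esymm_eq_multiset_esymm σ ℚ,
      aeval_esymm_eq_zero_of_sum_pow_eq_zero x h j.succ_pos (by simpa using hj)]
    simp

namespace Polynomial

theorem eq_of_X_sub_C_mul_eq {A : Type*} [CommRing A] {a : A} {p q r : A[X]}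
    (hp : (X - C a) * p = r) (hq : r = (X - C a) * q) : p = q :=
  (monic_X_sub_C a).isRegular.left (hp.trans hq)

/-- The relation between the top Chern class and the top-degree monomial holds for all roots
`a, …, g` of `T ^ 7` counted with multiplicity, in any commutative ring. -/
theorem prod_roots_eq_of_prod_X_sub_C_eq_X_pow {A : Type*} [CommRing A] (a b c d e f g : A)
    (h : (X - C a) * ((X - C b) *
      ((X - C c) * ((X - C d) *
      (X - C e) * (X - C f) *
      (X - C g)))) = X ^ 7) :
    (a - b) * (a - c) * (a - d) * (a - e) * (a - f) * (a - g) *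
        ((b - d) * (b - e) * (b - f) * (b - g)) * ((c - d) * (c - e) * (c - f) * (c - g)) =
      105 * (b * c * d ^ 3 * e ^ 3 * f ^ 3 * g ^ 3) := by
  have ha : a ^ 7 = 0 := by simpa using (congrArg (eval a) h).symm
  have hCa : (C a : A[X]) ^ 7 = 0 := by rw [← C_pow, ha, C_0]
  have h₁ := eq_of_X_sub_C_mul_eq h (q := X ^ 6 + X ^ 5 * C a + X ^ 4 * C a ^ 2 + X ^ 3 * C a ^ 3 +
    X ^ 2 * C a ^ 4 + X * C a ^ 5 + C a ^ 6) (by linear_combination hCa)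
  have hb : b ^ 6 + a * b ^ 5 + b ^ 4 * a ^ 2 + b ^ 3 * a ^ 3 + b ^ 2 * a ^ 4 + b * a ^ 5 +
      a ^ 6 = 0 := by simpa using (congrArg (eval b) h₁).symm
  have hCb := congrArg (C : A → A[X]) hb
  simp only [C_add, C_mul, C_pow, C_0] at hCb
  have h₂ := eq_of_X_sub_C_mul_eq h₁
    (q := X ^ 5 + X ^ 4 * (C a + C b) + X ^ 3 * (C a ^ 2 + C a * C b + C b ^ 2) +
      X ^ 2 * (C a ^ 3 + C a ^ 2 * C b + C a * C b ^ 2 + C b ^ 3) +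
      X * (C a ^ 4 + C a ^ 3 * C b + C a ^ 2 * C b ^ 2 + C a * C b ^ 3 + C b ^ 4) +
      (C a ^ 5 + C a ^ 4 * C b + C a ^ 3 * C b ^ 2 + C a ^ 2 * C b ^ 3 + C a * C b ^ 4 + C b ^ 5))
    (by linear_combination hCb)
  have hc : c ^ 5 + c ^ 4 * (a + b) + c ^ 3 * (a ^ 2 + a * b + b ^ 2) +
      c ^ 2 * (a ^ 3 + a ^ 2 * b + a * b ^ 2 + b ^ 3) +
      c * (a ^ 4 + a ^ 3 * b + a ^ 2 * b ^ 2 + a * b ^ 3 + b ^ 4) +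
      (a ^ 5 + a ^ 4 * b + a ^ 3 * b ^ 2 + a ^ 2 * b ^ 3 + a * b ^ 4 + b ^ 5) = 0 := by
    simpa using (congrArg (eval c) h₂).symm
  have hCc := congrArg (C : A → A[X]) hc
  simp only [C_add, C_mul, C_pow, C_0] at hCc
  have h₃ := eq_of_X_sub_C_mul_eq h₂
    (q := X ^ 4 + X ^ 3 * (C a + C b + C c) +
      X ^ 2 * (C a ^ 2 + C b ^ 2 + C c ^ 2 + C a * C b + C a * C c + C b * C c) +
      X * (C a ^ 3 + C a ^ 2 * (C b + C c) + C a * (C b ^ 2 + C b * C c + C c ^ 2) +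
        (C b ^ 3 + C b ^ 2 * C c + C b * C c ^ 2 + C c ^ 3)) +
      (C a ^ 4 + C a ^ 3 * (C b + C c) + C a ^ 2 * (C b ^ 2 + C b * C c + C c ^ 2) +
        C a * (C b ^ 3 + C b ^ 2 * C c + C b * C c ^ 2 + C c ^ 3) +
        (C b ^ 4 + C b ^ 3 * C c + C b ^ 2 * C c ^ 2 + C b * C c ^ 3 + C c ^ 4)))
    (by linear_combination hCc)
  have da := congrArg (eval a) h₁
  have d0 := congrArg (eval 0) h₁
  have gb := congrArg (eval b) h₃
  have gc := congrArg (eval c) h₃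
  have g0 := congrArg (eval 0) h₃
  simp only [eval_add, eval_sub, eval_mul, eval_pow, eval_X, eval_C] at da d0 gb gc g0
  -- Once multiplied by `a ^ 6`, everything may be computed modulo `a`.
  have ub : a ^ 6 * ((b - d) * (b - e) * (b - f) * (b - g)) =
      a ^ 6 * (5 * b ^ 4 + 4 * b ^ 3 * c + 3 * b ^ 2 * c ^ 2 + 2 * b * c ^ 3 + c ^ 4) := by
    linear_combination a ^ 6 * gb + (b ^ 3 + b ^ 2 * (a + b + c) +
      b * (c ^ 2 + b * c + b ^ 2 + a * c + a * b + a ^ 2) +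
      (c ^ 3 + b * c ^ 2 + b ^ 2 * c + b ^ 3 + a * c ^ 2 + a * b * c + a * b ^ 2 +
        a ^ 2 * c + a ^ 2 * b + a ^ 3)) * ha
  have uc : a ^ 6 * ((c - d) * (c - e) * (c - f) * (c - g)) =
      a ^ 6 * (5 * c ^ 4 + 4 * c ^ 3 * b + 3 * c ^ 2 * b ^ 2 + 2 * c * b ^ 3 + b ^ 4) := by
    linear_combination a ^ 6 * gc + (c ^ 3 + c ^ 2 * (a + b + c) +
      c * (c ^ 2 + b * c + b ^ 2 + a * c + a * b + a ^ 2) +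
      (c ^ 3 + b * c ^ 2 + b ^ 2 * c + b ^ 3 + a * c ^ 2 + a * b * c + a * b ^ 2 +
        a ^ 2 * c + a ^ 2 * b + a ^ 3)) * ha
  have u0 : a ^ 6 * (d * e * f * g) =
      a ^ 6 * (b ^ 4 + b ^ 3 * c + b ^ 2 * c ^ 2 + b * c ^ 3 + c ^ 4) := by
    linear_combination a ^ 6 * g0 + (c ^ 3 + b * c ^ 2 + b ^ 2 * c + b ^ 3 + a * c ^ 2 + a * b * c +
      a * b ^ 2 + a ^ 2 * c + a ^ 2 * b + a ^ 3) * ha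
  have r₆ : a ^ 6 * b ^ 6 = 0 := by
    linear_combination a ^ 6 * hb -
      (b ^ 5 + b ^ 4 * a + b ^ 3 * a ^ 2 + b ^ 2 * a ^ 3 + b * a ^ 4 + a ^ 5) * ha
  have r₅ : a ^ 6 * (b ^ 5 + b ^ 4 * c + b ^ 3 * c ^ 2 + b ^ 2 * c ^ 3 + b * c ^ 4 + c ^ 5) = 0 := by
    linear_combination a ^ 6 * hc - (c ^ 4 + b * c ^ 3 + b ^ 2 * c ^ 2 + b ^ 3 * c + b ^ 4 +
      a * (c ^ 3 + b * c ^ 2 + b ^ 2 * c + b ^ 3) + a ^ 2 * (c ^ 2 + b * c + b ^ 2) +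
      a ^ 3 * (c + b) + a ^ 4) * ha
  have top : a ^ 6 * ((b - d) * (b - e) * (b - f) * (b - g)) *
      ((c - d) * (c - e) * (c - f) * (c - g)) = 15 * (a ^ 6 * (d * e * f * g) ^ 2) := by
    linear_combination
      ((c - d) * (c - e) * (c - f) * (c - g)) * ub +
      (5 * b ^ 4 + 4 * b ^ 3 * c + 3 * b ^ 2 * c ^ 2 + 2 * b * c ^ 3 + c ^ 4) * uc -
      15 * (d * e * f * g + (b ^ 4 + b ^ 3 * c + b ^ 2 * c ^ 2 + b * c ^ 3 + c ^ 4)) * u0 -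
      (10 * c ^ 3 + 6 * b * c ^ 2 + 3 * b ^ 2 * c + b ^ 3) * r₅ -
      (9 * c ^ 2 + 12 * b * c + 9 * b ^ 2) * r₆
  linear_combination
    ((b - d) * (b - e) * (b - f) * (b - g)) * ((c - d) * (c - e) * (c - f) * (c - g)) * da +
    7 * top - 105 * (d * e * f * g) ^ 2 * d0

end Polynomial

/-- In `ℚ[x₁,…,x₇]`, the product `P` of the 14 complementary positive roots of
`SU(7)/S(U(1)×U(2)×U(4))` satisfies `P = 105·x₂x₃x₄³x₅³x₆³x₇³` modulo the ideal generated by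
the power sums `e₁,…,e₇`. -/
theorem top_chern_class_F7_124 :
    ((X 0 - X 1) * (X 0 - X 2) * (X 0 - X 3) * (X 0 - X 4) * (X 0 - X 5) * (X 0 - X 6) *
        ((X 1 - X 3) * (X 1 - X 4) * (X 1 - X 5) * (X 1 - X 6)) *
        ((X 2 - X 3) * (X 2 - X 4) * (X 2 - X 5) * (X 2 - X 6)) -
      105 * (X 1 * X 2 * X 3 ^ 3 * X 4 ^ 3 * X 5 ^ 3 * X 6 ^ 3) :
      MvPolynomial (Fin 7) ℚ) ∈ powerSumIdeal7 := by
  rw [← Ideal.Quotient.eq]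
  let x : Fin 7 → MvPolynomial (Fin 7) ℚ ⧸ powerSumIdeal7 := fun i =>
    Ideal.Quotient.mk powerSumIdeal7 (X i)
  have hx : ∀ k, 0 < k → k ≤ Fintype.card (Fin 7) → ∑ i, x i ^ k = 0 := by
    intro k hk hk'
    rw [Fintype.card_fin] at hk'
    have hmem : ∑ i, (X i : MvPolynomial (Fin 7) ℚ) ^ k ∈ powerSumIdeal7 :=
      Ideal.subset_span ⟨⟨k - 1, by omega⟩, by simp [Nat.sub_add_cancel hk]⟩
    simpa [x] using Ideal.Quotient.eq_zero_iff_mem.mpr hmem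
  have hprod := prod_X_sub_C_eq_X_pow_of_sum_pow_eq_zero x hx
  rw [Fintype.card_fin] at hprod
  have key := Polynomial.prod_roots_eq_of_prod_X_sub_C_eq_X_pow (x 0) (x 1) (x 2) (x 3) (x 4) (x 5)
    (x 6)
    (by rw [← hprod, Fin.prod_univ_seven]; ring)
  simpa only [map_mul, map_sub, map_pow, map_ofNat] using key
end

section
/- In the quotient ring ℚ[x₁,…,x₇]/⟨e₁,…,e₇⟩, where e_k = x₁^k + ⋯ + x₇^k, one has (6x₁ + 3x₂ + 3x₃ − 3x₄ − 3x₅ − 3x₆ − 3x₇)¹⁴ = 4169710642825728 · x₂x₃x₄³x₅³x₆³x₇³. -/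
open MvPolynomial

/-- Every elementary symmetric polynomial of positive degree lies in the ideal generated by the
power sums (Newton's identities). -/
theorem esymm_mem_powerSumIdeal7 {k : ℕ} (hk : 0 < k) (hk7 : k ≤ 7) :
    esymm (Fin 7) ℚ k ∈ powerSumIdeal7 := by
  have hmul : (k : MvPolynomial (Fin 7) ℚ) * esymm (Fin 7) ℚ k ∈ powerSumIdeal7 := by
    rw [mul_esymm_eq_sum]
    refine Ideal.mul_mem_left _ _ (Ideal.sum_mem _ fun p hp => Ideal.mul_mem_left _ _ ?_)
    obtain ⟨hsum, hlt⟩ : p.1 + p.2 = k ∧ p.1 < k := by simpa using hp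
    refine Ideal.subset_span ⟨⟨p.2 - 1, by omega⟩, ?_⟩
    have hp2 : p.2 - 1 + 1 = p.2 := by omega
    simp [psum, hp2]
  have hk0 : (k : ℚ) ≠ 0 := by exact_mod_cast hk.ne'
  have hcancel : esymm (Fin 7) ℚ k = C ((k : ℚ)⁻¹) * ((k : MvPolynomial (Fin 7) ℚ) *
      esymm (Fin 7) ℚ k) := by
    rw [← mul_assoc, ← map_natCast (C : ℚ →+* MvPolynomial (Fin 7) ℚ) k, ← C_mul,
      inv_mul_cancel₀ hk0, C_1, one_mul]
  rw [hcancel]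
  exact Ideal.mul_mem_left _ _ hmul

/-- The total Chern class relation: modulo the power sums, `∏ (T + xᵢ) = T ^ 7`. -/
theorem prod_X_add_C_mk_powerSumIdeal7 :
    ∏ i : Fin 7, (Polynomial.X + Polynomial.C (Ideal.Quotient.mk powerSumIdeal7 (X i))) =
      Polynomial.X ^ 7 := by
  have h := congrArg (Polynomial.map (Ideal.Quotient.mk powerSumIdeal7))
    (prod_C_add_X_eq_sum_esymm ℚ (Fin 7))
  simp only [Polynomial.map_prod, Polynomial.map_add, Polynomial.map_X, Polynomial.map_C,
    Polynomial.map_sum, Polynomial.map_mul, Polynomial.map_pow, Fintype.card_fin] at h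
  rw [h, Finset.sum_eq_single 0]
  · simp
  · intro k hk hk0
    rw [Ideal.Quotient.eq_zero_iff_mem.mpr (esymm_mem_powerSumIdeal7 (Nat.pos_of_ne_zero hk0)
      (by simpa [Nat.lt_succ_iff] using hk))]
    simp
  · simp

/-- If `(T + a)(T + b)(T + c)(T⁴ + f₁T³ + f₂T² + f₃T + f₄) = T⁷`, then the coefficients of the
product satisfy the Whitney sum relations. -/
theorem coeff_relations_of_mul_eq_X_pow {R : Type*} [CommRing R] {s₁ s₂ s₃ f₁ f₂ f₃ f₄ : R}
    (h : (Polynomial.X ^ 3 + Polynomial.C s₁ * Polynomial.X ^ 2 + Polynomial.C s₂ * Polynomial.X +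
        Polynomial.C s₃) * (Polynomial.X ^ 4 + Polynomial.C f₁ * Polynomial.X ^ 3 +
        Polynomial.C f₂ * Polynomial.X ^ 2 + Polynomial.C f₃ * Polynomial.X + Polynomial.C f₄) =
      Polynomial.X ^ 7) :
    f₁ + s₁ = 0 ∧ f₂ + s₁ * f₁ + s₂ = 0 ∧ f₃ + s₁ * f₂ + s₂ * f₁ + s₃ = 0 ∧
      f₄ + s₁ * f₃ + s₂ * f₂ + s₃ * f₁ = 0 ∧ s₁ * f₄ + s₂ * f₃ + s₃ * f₂ = 0 ∧
      s₂ * f₄ + s₃ * f₃ = 0 ∧ s₃ * f₄ = 0 := by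
  have hexp : Polynomial.C (f₁ + s₁) * Polynomial.X ^ 6 +
      Polynomial.C (f₂ + s₁ * f₁ + s₂) * Polynomial.X ^ 5 +
      Polynomial.C (f₃ + s₁ * f₂ + s₂ * f₁ + s₃) * Polynomial.X ^ 4 +
      Polynomial.C (f₄ + s₁ * f₃ + s₂ * f₂ + s₃ * f₁) * Polynomial.X ^ 3 +
      Polynomial.C (s₁ * f₄ + s₂ * f₃ + s₃ * f₂) * Polynomial.X ^ 2 +
      Polynomial.C (s₂ * f₄ + s₃ * f₃) * Polynomial.X ^ 1 +
      Polynomial.C (s₃ * f₄) * Polynomial.X ^ 0 = 0 := by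
    simp only [Polynomial.C_add, Polynomial.C_mul]
    linear_combination h
  have hcoeff (n : ℕ) := congrArg (fun p => Polynomial.coeff p n) hexp
  simp only [Polynomial.coeff_add, Polynomial.coeff_C_mul_X_pow, Polynomial.coeff_zero] at hcoeff
  exact ⟨by simpa using hcoeff 6, by simpa using hcoeff 5, by simpa using hcoeff 4,
    by simpa using hcoeff 3, by simpa using hcoeff 2, by simpa using hcoeff 1,
    by simpa using hcoeff 0⟩

/-- The top-degree computation modulo the complete homogeneous polynomials `h₅(a, b, c)`,
`h₆(a, b)` and `h₇(a)`. -/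
theorem chern_pow_eq_of_complete_homogeneous_eq_zero {R : Type*} [CommRing R] {a b c : R}
    (h₅ : a ^ 5 + a ^ 4 * b + a ^ 4 * c + a ^ 3 * b ^ 2 + a ^ 3 * b * c + a ^ 3 * c ^ 2 +
      a ^ 2 * b ^ 3 + a ^ 2 * b ^ 2 * c + a ^ 2 * b * c ^ 2 + a ^ 2 * c ^ 3 + a * b ^ 4 +
      a * b ^ 3 * c + a * b ^ 2 * c ^ 2 + a * b * c ^ 3 + a * c ^ 4 + b ^ 5 + b ^ 4 * c +
      b ^ 3 * c ^ 2 + b ^ 2 * c ^ 3 + b * c ^ 4 + c ^ 5 = 0)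
    (h₆ : a ^ 6 + a ^ 5 * b + a ^ 4 * b ^ 2 + a ^ 3 * b ^ 3 + a ^ 2 * b ^ 4 + a * b ^ 5 + b ^ 6 =
      0)
    (h₇ : a ^ 7 = 0) : (3 * a + 2 * b + 2 * c) ^ 14 = 871782912 * (b * c * (a ^ 4 + a ^ 3 * b +
      a ^ 3 * c + a ^ 2 * b ^ 2 + a ^ 2 * b * c + a ^ 2 * c ^ 2 + a * b ^ 3 + a * b ^ 2 * c +
      a * b * c ^ 2 + a * c ^ 3 + b ^ 4 + b ^ 3 * c + b ^ 2 * c ^ 2 + b * c ^ 3 + c ^ 4) ^ 3) :=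
      by
  linear_combination
    (16773120 * a ^ 9 + 586951104 * a ^ 8 * b + 303241920 * a ^ 8 * c + 2305448960 * a ^ 7 * b ^ 2 +
      976234752 * a ^ 7 * b * c + 400636160 * a ^ 7 * c ^ 2 + 3803145216 * a ^ 6 * b ^ 3 +
      2747536384 * a ^ 6 * b ^ 2 * c + 187334912 * a ^ 6 * b * c ^ 2 + 311367424 * a ^ 6 * c ^ 3 +
      3055902720 * a ^ 5 * b ^ 4 + 3121157632 * a ^ 5 * b ^ 3 * c +
      332632064 * a ^ 5 * b ^ 2 * c ^ 2 - 1369928192 * a ^ 5 * b * c ^ 3 +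
      166053888 * a ^ 5 * c ^ 4 + 25419264 * a ^ 4 * b ^ 5 - 199920128 * a ^ 4 * b ^ 4 * c -
      2088987136 * a ^ 4 * b ^ 3 * c ^ 2 - 4082141696 * a ^ 4 * b ^ 2 * c ^ 3 -
      3812949504 * a ^ 4 * b * c ^ 4 + 62899200 * a ^ 4 * c ^ 5 - 375877632 * a ^ 3 * b ^ 6 -
      2690728448 * a ^ 3 * b ^ 5 * c - 4575182848 * a ^ 3 * b ^ 4 * c ^ 2 -
      6148590080 * a ^ 3 * b ^ 3 * c ^ 3 - 6269792256 * a ^ 3 * b ^ 2 * c ^ 4 -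
      3322755072 * a ^ 3 * b * c ^ 5 + 16773120 * a ^ 3 * c ^ 6 - 389640192 * a ^ 2 * b ^ 7 -
      2312494592 * a ^ 2 * b ^ 6 * c - 5302437376 * a ^ 2 * b ^ 5 * c ^ 2 -
      7071111680 * a ^ 2 * b ^ 4 * c ^ 3 - 7400999424 * a ^ 2 * b ^ 3 * c ^ 4 -
      5071911936 * a ^ 2 * b ^ 2 * c ^ 5 - 2582576640 * a ^ 2 * b * c ^ 6 +
      3010560 * a ^ 2 * c ^ 7 - 116260864 * a * b ^ 8 - 1745630208 * a * b ^ 7 * c -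
      3355404288 * a * b ^ 6 * c ^ 2 - 5922059776 * a * b ^ 5 * c ^ 3 -
      6837096448 * a * b ^ 4 * c ^ 4 - 5163604992 * a * b ^ 3 * c ^ 5 -
      3466029056 * a * b ^ 2 * c ^ 6 - 1739650048 * a * b * c ^ 7 + 327680 * a * c ^ 8 -
      11927552 * b ^ 9 - 877550080 * b ^ 8 * c - 1736324096 * b ^ 7 * c ^ 2 -
      2598931968 * b ^ 6 * c ^ 3 - 4342514176 * b ^ 5 * c ^ 4 - 3476695040 * b ^ 4 * c ^ 5 -
      2610875904 * b ^ 3 * c ^ 6 - 1742304256 * b ^ 2 * c ^ 7 - 871569920 * b * c ^ 8 +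
      16384 * c ^ 9) * h₅ +
    (-559771392 * a ^ 8 - 2009457408 * a ^ 7 * b - 2285519616 * a ^ 7 * c -
      3503721728 * a ^ 6 * b ^ 2 - 6174547968 * a ^ 6 * b * c - 3884428544 * a ^ 6 * c ^ 2 -
      2889848832 * a ^ 5 * b ^ 3 - 7392878592 * a ^ 5 * b ^ 2 * c - 7503503360 * a ^ 5 * b * c ^ 2 -
      3282499584 * a ^ 5 * c ^ 3 + 37479936 * a ^ 4 * b ^ 4 - 3575549440 * a ^ 4 * b ^ 3 * c -
      5580647936 * a ^ 4 * b ^ 2 * c ^ 2 - 3698118144 * a ^ 4 * b * c ^ 3 -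
      355170816 * a ^ 4 * c ^ 4 + 392650752 * a ^ 3 * b ^ 5 - 239375872 * a ^ 3 * b ^ 4 * c -
      1933985280 * a ^ 3 * b ^ 3 * c ^ 2 - 1945929216 * a ^ 3 * b ^ 2 * c ^ 3 -
      361944576 * a ^ 3 * b * c ^ 4 + 392650752 * a ^ 2 * b ^ 6 + 122568704 * a ^ 2 * b ^ 5 * c +
      353094144 * a ^ 2 * b ^ 4 * c ^ 2 + 23206400 * a ^ 2 * b ^ 3 * c ^ 3 +
      341150208 * a ^ 2 * b ^ 2 * c ^ 4 + 116588544 * a * b ^ 7 + 122568704 * a * b ^ 6 * c +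
      11943936 * a * b ^ 5 * c ^ 2 + 770398720 * a * b ^ 4 * c ^ 3 + 770398720 * a * b ^ 3 * c ^ 4 +
      11943936 * b ^ 8 + 17924096 * b ^ 7 * c + 11943936 * b ^ 6 * c ^ 2 +
      865819136 * b ^ 4 * c ^ 4) * h₆ +
    (547781241 * a ^ 7 + 2010145620 * a ^ 6 * b + 2010145620 * a ^ 6 * c +
      3357221868 * a ^ 5 * b ^ 2 + 6091972824 * a ^ 5 * b * c + 3357221868 * a ^ 5 * c ^ 2 +
      2766333024 * a ^ 4 * b ^ 3 + 7848967392 * a ^ 4 * b ^ 2 * c + 7848967392 * a ^ 4 * b * c ^ 2 +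
      2766333024 * a ^ 4 * c ^ 3 + 102827088 * a ^ 3 * b ^ 4 + 4120224192 * a ^ 3 * b ^ 3 * c +
      6940116960 * a ^ 3 * b ^ 2 * c ^ 2 + 4120224192 * a ^ 3 * b * c ^ 3 +
      102827088 * a ^ 3 * c ^ 4 + 538429248 * a ^ 2 * b ^ 4 * c +
      3128084736 * a ^ 2 * b ^ 3 * c ^ 2 + 3128084736 * a ^ 2 * b ^ 2 * c ^ 3 +
      538429248 * a ^ 2 * b * c ^ 4 + 354427584 * a * b ^ 4 * c ^ 2 +
      1352550528 * a * b ^ 3 * c ^ 3 + 354427584 * a * b ^ 2 * c ^ 4 + 361693696 * b ^ 4 * c ^ 3 +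
      361693696 * b ^ 3 * c ^ 4) * h₇

/-- In `ℚ[x₁,…,x₇]/⟨e₁,…,e₇⟩`, the Chern number identity
`(6x₁+3x₂+3x₃−3x₄−3x₅−3x₆−3x₇)¹⁴ = 4169710642825728·x₂x₃x₄³x₅³x₆³x₇³` for the canonical
invariant complex structure on `SU(7)/S(U(1)×U(2)×U(4))`. -/
theorem chern_number_F7_124_J1 :
    Ideal.Quotient.mk powerSumIdeal7
        ((6 * X 0 + 3 * X 1 + 3 * X 2 - 3 * X 3 - 3 * X 4 - 3 * X 5 - 3 * X 6) ^ 14) =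
      Ideal.Quotient.mk powerSumIdeal7
        (4169710642825728 * (X 1 * X 2 * X 3 ^ 3 * X 4 ^ 3 * X 5 ^ 3 * X 6 ^ 3)) := by
  have hprod := prod_X_add_C_mk_powerSumIdeal7
  simp only [Fin.prod_univ_succ, Fin.prod_univ_zero, Fin.succ_zero_eq_one, Fin.reduceSucc,
    mul_one] at hprod
  simp only [map_mul, map_pow, map_add, map_sub, map_ofNat]
  generalize Ideal.Quotient.mk powerSumIdeal7 (X 0) = a at *
  generalize Ideal.Quotient.mk powerSumIdeal7 (X 1) = b at *
  generalize Ideal.Quotient.mk powerSumIdeal7 (X 2) = c at *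
  generalize Ideal.Quotient.mk powerSumIdeal7 (X 3) = p at *
  generalize Ideal.Quotient.mk powerSumIdeal7 (X 4) = q at *
  generalize Ideal.Quotient.mk powerSumIdeal7 (X 5) = r at *
  generalize Ideal.Quotient.mk powerSumIdeal7 (X 6) = s at *
  obtain ⟨r₁, r₂, r₃, r₄, r₅, r₆, r₇⟩ := coeff_relations_of_mul_eq_X_pow
    (s₁ := a + b + c) (s₂ := a * b + a * c + b * c) (s₃ := a * b * c)
    (f₁ := p + q + r + s) (f₂ := p * q + p * r + p * s + q * r + q * s + r * s)
    (f₃ := p * q * r + p * q * s + p * r * s + q * r * s) (f₄ := p * q * r * s) (by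
      rw [← hprod]
      simp only [map_add, map_mul]
      ring)
  have hlin : p + q + r + s = -(a + b + c) := by linear_combination r₁
  generalize p * q + p * r + p * s + q * r + q * s + r * s = f₂ at *
  generalize p * q * r + p * q * s + p * r * s + q * r * s = f₃ at *
  have hf₂ : f₂ = a ^ 2 + a * b + a * c + b ^ 2 + b * c + c ^ 2 := by
    linear_combination r₂ - (a + b + c) * hlin
  have hf₃ : f₃ = -(a ^ 3 + a ^ 2 * b + a ^ 2 * c + a * b ^ 2 + a * b * c + a * c ^ 2 + b ^ 3 +
      b ^ 2 * c + b * c ^ 2 + c ^ 3) := by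
    linear_combination r₃ - (a + b + c) * hf₂ - (a * b + a * c + b * c) * hlin
  have hf₄ : p * q * r * s = a ^ 4 + a ^ 3 * b + a ^ 3 * c + a ^ 2 * b ^ 2 + a ^ 2 * b * c +
      a ^ 2 * c ^ 2 + a * b ^ 3 + a * b ^ 2 * c + a * b * c ^ 2 + a * c ^ 3 + b ^ 4 + b ^ 3 * c +
      b ^ 2 * c ^ 2 + b * c ^ 3 + c ^ 4 := by
    linear_combination r₄ - (a + b + c) * hf₃ - (a * b + a * c + b * c) * hf₂ -
      a * b * c * hlin
  rw [hf₄, hf₃, hf₂] at r₅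
  rw [hf₄, hf₃] at r₆
  rw [hf₄] at r₇
  have h₅ : a ^ 5 + a ^ 4 * b + a ^ 4 * c + a ^ 3 * b ^ 2 + a ^ 3 * b * c + a ^ 3 * c ^ 2 +
      a ^ 2 * b ^ 3 + a ^ 2 * b ^ 2 * c + a ^ 2 * b * c ^ 2 + a ^ 2 * c ^ 3 + a * b ^ 4 +
      a * b ^ 3 * c + a * b ^ 2 * c ^ 2 + a * b * c ^ 3 + a * c ^ 4 + b ^ 5 + b ^ 4 * c +
      b ^ 3 * c ^ 2 + b ^ 2 * c ^ 3 + b * c ^ 4 + c ^ 5 = 0 := by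
    linear_combination r₅
  have h₆ : a ^ 6 + a ^ 5 * b + a ^ 4 * b ^ 2 + a ^ 3 * b ^ 3 + a ^ 2 * b ^ 4 + a * b ^ 5 + b ^ 6
      = 0 := by
    linear_combination -r₆ + (a + b) * h₅
  have h₇ : a ^ 7 = 0 := by
    linear_combination r₇ + a * h₆ - a * b * h₅
  have key := chern_pow_eq_of_complete_homogeneous_eq_zero h₅ h₆ h₇
  rw [← hf₄] at key
  have hchern : 6 * a + 3 * b + 3 * c - 3 * p - 3 * q - 3 * r - 3 * s =
      3 * (3 * a + 2 * b + 2 * c) := by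
    linear_combination -3 * hlin
  rw [hchern]
  linear_combination 3 ^ 14 * key
end

section
/- In the quotient ring ℚ[x₁,…,x₇]/⟨e₁,…,e₇⟩, where e_k = x₁^k + ⋯ + x₇^k, one has (−2x₁ + 3x₂ + 3x₃ − x₄ − x₅ − x₆ − x₇)¹⁴ = 68881612800 · x₂x₃x₄³x₅³x₆³x₇³. -/
open MvPolynomial

/-- The complete homogeneous symmetric polynomial of degree `n` in three variables `a, b, c`,
written in terms of `a`, `s = b + c` and `p = b * c`. -/
def completeHomogeneous {R : Type*} [CommRing R] (a s p : R) : ℕ → R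
  | 0 => 1
  | 1 => a + s
  | n + 2 => s * completeHomogeneous a s p (n + 1) - p * completeHomogeneous a s p n + a ^ (n + 2)

/-- The top-degree relation in the ring `ℤ[a, s, p] / (h₅, h₆, h₇)`. -/
theorem pow_fourteen_eq_of_completeHomogeneous_eq_zero {R : Type*} [CommRing R] {a s p : R}
    (h5 : completeHomogeneous a s p 5 = 0) (h6 : completeHomogeneous a s p 6 = 0)
    (h7 : completeHomogeneous a s p 7 = 0) :
    (4 * s - a) ^ 14 = 68881612800 * (p * completeHomogeneous a s p 4 ^ 3) := by
  simp only [completeHomogeneous] at h5 h6 h7 ⊢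
  linear_combination
    (268435456 * s ^ 9 - 1207959552 * s ^ 8 * a - 67807870976 * s ^ 7 * p +
      2466250752 * s ^ 7 * a ^ 2 - 142863499264 * s ^ 6 * p * a - 3053453312 * s ^ 6 * a ^ 3
      + 445876666368 * s ^ 5 * p ^ 2 + 484744232960 * s ^ 5 * p * a ^ 2 +
      375205003264 * s ^ 5 * a ^ 4 - 54269050880 * s ^ 4 * p ^ 2 * a -
      501776699136 * s ^ 4 * p * a ^ 3 + 81966137344 * s ^ 4 * a ^ 5 -
      667660189696 * s ^ 3 * p ^ 3 - 2137532764160 * s ^ 3 * p ^ 2 * a ^ 2 -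
      1312814732032 * s ^ 3 * p * a ^ 4 + 229175984128 * s ^ 3 * a ^ 6 +
      1252125650944 * s ^ 2 * p ^ 3 * a + 442357757952 * s ^ 2 * p ^ 2 * a ^ 3 -
      220632625744 * s ^ 2 * p * a ^ 5 - 54551642112 * s ^ 2 * a ^ 7 -
      124885401600 * s * p ^ 4 + 2179196434432 * s * p ^ 3 * a ^ 2 +
      380194586624 * s * p ^ 2 * a ^ 4 - 527487776824 * s * p * a ^ 6 +
      703532003328 * s * a ^ 8 - 675323494400 * p ^ 4 * a + 609509685248 * p ^ 3 * a ^ 3 -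
      678391298048 * p ^ 2 * a ^ 5 + 678391298049 * p * a ^ 7 - 3067803648 * a ^ 9) * h5 +
    (-375207309568 * s ^ 5 * a ^ 3 - 97978941440 * s ^ 4 * p ^ 2 +
      172707909632 * s ^ 4 * p * a ^ 2 - 457173167360 * s ^ 4 * a ^ 4 -
      112465752064 * s ^ 3 * p ^ 2 * a + 1890580711424 * s ^ 3 * p * a ^ 3 -
      313720524208 * s ^ 3 * a ^ 5 + 324763516928 * s ^ 2 * p ^ 3 -
      334658844672 * s ^ 2 * p ^ 2 * a ^ 2 + 1316851482624 * s ^ 2 * p * a ^ 4 -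
      175628306376 * s ^ 2 * a ^ 6 - 49664835584 * s * p ^ 3 * a -
      1562852440064 * s * p ^ 2 * a ^ 3 + 1014421370880 * s * p * a ^ 5 -
      650974377985 * s * a ^ 7 + 68881612800 * p ^ 4 - 292756783104 * p ^ 3 * a ^ 2 -
      91391131648 * p ^ 2 * a ^ 4 + 113600233472 * p * a ^ 6 - 700997222400 * a ^ 8) * h6 +
    (375207309568 * s ^ 4 * a ^ 3 - 853292453888 * s ^ 3 * p * a ^ 2 +
      84544515328 * s ^ 3 * a ^ 4 + 700473618432 * s ^ 2 * p ^ 2 * a -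
      1302863693824 * s ^ 2 * p * a ^ 3 + 230179950000 * s ^ 2 * a ^ 5 -
      226516140032 * s * p ^ 3 + 1595947530240 * s * p ^ 2 * a ^ 2 -
      624696819712 * s * p * a ^ 4 - 52557625400 * s * a ^ 6 - 520329936896 * p ^ 3 * a +
      907545655296 * p ^ 2 * a ^ 3 - 860873144320 * p * a ^ 5 + 704065026049 * a ^ 7) * h7

/-- Nonzero natural numbers can be cancelled in a `ℚ`-algebra. -/
theorem eq_zero_of_natCast_mul_eq_zero {R : Type*} [CommRing R] [Algebra ℚ R] {n : ℕ}
    (hn : n ≠ 0) {y : R} (h : (n : R) * y = 0) : y = 0 := by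
  have hu : IsUnit (algebraMap ℚ R n) := (IsUnit.mk0 (n : ℚ) (by exact_mod_cast hn)).map _
  rw [map_natCast] at hu
  exact hu.mul_right_eq_zero.mp h

/-- If the first seven power sums of `a, b, c, w, x, y, z` vanish, then
`(1 - w t)(1 - x t)(1 - y t)(1 - z t)` is the inverse of `(1 - a t)(1 - b t)(1 - c t)` modulo
`t ^ 8`; this compares the coefficients in degrees four to seven. -/
theorem completeHomogeneous_of_sum_pow_eq_zero {R : Type*} [CommRing R] [Algebra ℚ R]
    {a b c w x y z : R}
    (h : ∀ k ∈ Finset.Icc 1 7, a ^ k + b ^ k + c ^ k + w ^ k + x ^ k + y ^ k + z ^ k = 0) :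
    completeHomogeneous a (b + c) (b * c) 4 = w * x * y * z ∧
      completeHomogeneous a (b + c) (b * c) 5 = 0 ∧
      completeHomogeneous a (b + c) (b * c) 6 = 0 ∧
      completeHomogeneous a (b + c) (b * c) 7 = 0 := by
  have p1 := h 1 (by decide)
  have p2 := h 2 (by decide)
  have p3 := h 3 (by decide)
  have p4 := h 4 (by decide)
  have p5 := h 5 (by decide)
  have p6 := h 6 (by decide)
  have p7 := h 7 (by decide)
  obtain ⟨d1, hd1⟩ : ∃ d, d = w + x + y + z := ⟨_, rfl⟩
  obtain ⟨d2, hd2⟩ : ∃ d, d = w * x + w * y + w * z + x * y + x * z + y * z := ⟨_, rfl⟩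
  obtain ⟨d3, hd3⟩ : ∃ d, d = w * x * y + w * x * z + w * y * z + x * y * z := ⟨_, rfl⟩
  obtain ⟨d4, hd4⟩ : ∃ d, d = w * x * y * z := ⟨_, rfl⟩
  have n2 : -(a ^ 2 + b ^ 2 + c ^ 2) + d1 * (a ^ 1 + b ^ 1 + c ^ 1) + 2 * d2 = 0 := by
    linear_combination (norm := (subst hd1 hd2 hd3 hd4; ring)) -p2 + d1 * p1
  have n3 : -(a ^ 3 + b ^ 3 + c ^ 3) + d1 * (a ^ 2 + b ^ 2 + c ^ 2) -
      d2 * (a ^ 1 + b ^ 1 + c ^ 1) - 3 * d3 = 0 := by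
    linear_combination (norm := (subst hd1 hd2 hd3 hd4; ring)) -p3 + d1 * p2 - d2 * p1
  have n4 : -(a ^ 4 + b ^ 4 + c ^ 4) + d1 * (a ^ 3 + b ^ 3 + c ^ 3) -
      d2 * (a ^ 2 + b ^ 2 + c ^ 2) + d3 * (a ^ 1 + b ^ 1 + c ^ 1) + 4 * d4 = 0 := by
    linear_combination (norm := (subst hd1 hd2 hd3 hd4; ring)) -p4 + d1 * p3 - d2 * p2 + d3 * p1
  have n5 : -(a ^ 5 + b ^ 5 + c ^ 5) + d1 * (a ^ 4 + b ^ 4 + c ^ 4) -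
      d2 * (a ^ 3 + b ^ 3 + c ^ 3) + d3 * (a ^ 2 + b ^ 2 + c ^ 2) -
      d4 * (a ^ 1 + b ^ 1 + c ^ 1) = 0 := by
    linear_combination (norm := (subst hd1 hd2 hd3 hd4; ring))
      -p5 + d1 * p4 - d2 * p3 + d3 * p2 - d4 * p1
  have n6 : -(a ^ 6 + b ^ 6 + c ^ 6) + d1 * (a ^ 5 + b ^ 5 + c ^ 5) -
      d2 * (a ^ 4 + b ^ 4 + c ^ 4) + d3 * (a ^ 3 + b ^ 3 + c ^ 3) -
      d4 * (a ^ 2 + b ^ 2 + c ^ 2) = 0 := by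
    linear_combination (norm := (subst hd1 hd2 hd3 hd4; ring))
      -p6 + d1 * p5 - d2 * p4 + d3 * p3 - d4 * p2
  have n7 : -(a ^ 7 + b ^ 7 + c ^ 7) + d1 * (a ^ 6 + b ^ 6 + c ^ 6) -
      d2 * (a ^ 5 + b ^ 5 + c ^ 5) + d3 * (a ^ 4 + b ^ 4 + c ^ 4) -
      d4 * (a ^ 3 + b ^ 3 + c ^ 3) = 0 := by
    linear_combination (norm := (subst hd1 hd2 hd3 hd4; ring))
      -p7 + d1 * p6 - d2 * p5 + d3 * p4 - d4 * p3
  rw [← hd4]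
  have n1 : d1 + (a + b + c) = 0 := by linear_combination hd1 + p1
  clear hd1 hd2 hd3 hd4
  obtain rfl : d1 = -completeHomogeneous a (b + c) (b * c) 1 := by
    simp only [completeHomogeneous]
    linear_combination n1
  obtain rfl : d2 = completeHomogeneous a (b + c) (b * c) 2 := by
    refine sub_eq_zero.mp (eq_zero_of_natCast_mul_eq_zero (n := 2) (by decide) ?_)
    simp only [completeHomogeneous] at n2 ⊢
    push_cast
    linear_combination n2
  obtain rfl : d3 = -completeHomogeneous a (b + c) (b * c) 3 := by
    refine sub_eq_zero.mp (eq_zero_of_natCast_mul_eq_zero (n := 3) (by decide) ?_)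
    simp only [completeHomogeneous] at n3 ⊢
    push_cast
    linear_combination -n3
  obtain rfl : d4 = completeHomogeneous a (b + c) (b * c) 4 := by
    refine sub_eq_zero.mp (eq_zero_of_natCast_mul_eq_zero (n := 4) (by decide) ?_)
    simp only [completeHomogeneous] at n4 ⊢
    push_cast
    linear_combination n4
  have h5 : completeHomogeneous a (b + c) (b * c) 5 = 0 := by
    refine eq_zero_of_natCast_mul_eq_zero (n := 5) (by decide) ?_
    simp only [completeHomogeneous] at n5 ⊢
    push_cast
    linear_combination -n5
  have h6 : completeHomogeneous a (b + c) (b * c) 6 = 0 := by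
    refine eq_zero_of_natCast_mul_eq_zero (n := 6) (by decide) ?_
    simp only [completeHomogeneous] at n6 h5 ⊢
    push_cast
    linear_combination -n6 + (a + b + c) * h5
  have h7 : completeHomogeneous a (b + c) (b * c) 7 = 0 := by
    refine eq_zero_of_natCast_mul_eq_zero (n := 7) (by decide) ?_
    simp only [completeHomogeneous] at n7 h5 h6 ⊢
    push_cast
    linear_combination -n7 + (a ^ 2 + b ^ 2 + c ^ 2) * h5 + (a + b + c) * h6
  exact ⟨rfl, h5, h6, h7⟩

/-- In `ℚ[x₁,…,x₇]/⟨e₁,…,e₇⟩`, the Chern number identity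
`(−2x₁+3x₂+3x₃−x₄−x₅−x₆−x₇)¹⁴ = 68881612800·x₂x₃x₄³x₅³x₆³x₇³` for the non-integrable
invariant almost complex structure `J₄` on `SU(7)/S(U(1)×U(2)×U(4))`. -/
theorem chern_number_F7_124_J4 :
    Ideal.Quotient.mk powerSumIdeal7
        ((-2 * X 0 + 3 * X 1 + 3 * X 2 - X 3 - X 4 - X 5 - X 6) ^ 14) =
      Ideal.Quotient.mk powerSumIdeal7
        (68881612800 * (X 1 * X 2 * X 3 ^ 3 * X 4 ^ 3 * X 5 ^ 3 * X 6 ^ 3)) := by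
  have hsum : ∀ k ∈ Finset.Icc 1 7,
      ∑ i, Ideal.Quotient.mk powerSumIdeal7 (X i) ^ k = 0 := by
    intro k hk
    rw [Finset.mem_Icc] at hk
    simp only [← map_pow, ← map_sum]
    refine Ideal.Quotient.eq_zero_iff_mem.mpr (Ideal.subset_span ⟨⟨k - 1, by lia⟩, ?_⟩)
    simp only [Nat.sub_add_cancel hk.1]
  simp only [Fin.sum_univ_seven] at hsum
  obtain ⟨h4, h5, h6, h7⟩ := completeHomogeneous_of_sum_pow_eq_zero hsum
  have key := pow_fourteen_eq_of_completeHomogeneous_eq_zero h5 h6 h7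
  rw [h4] at key
  have h1 := hsum 1 (by decide)
  simp only [pow_one] at h1
  simp only [map_pow, map_mul, map_add, map_sub, map_neg, map_ofNat]
  generalize Ideal.Quotient.mk powerSumIdeal7 (X 0) = a at *
  generalize Ideal.Quotient.mk powerSumIdeal7 (X 1) = b at *
  generalize Ideal.Quotient.mk powerSumIdeal7 (X 2) = c at *
  generalize Ideal.Quotient.mk powerSumIdeal7 (X 3) = w at *
  generalize Ideal.Quotient.mk powerSumIdeal7 (X 4) = x at *
  generalize Ideal.Quotient.mk powerSumIdeal7 (X 5) = y at *
  generalize Ideal.Quotient.mk powerSumIdeal7 (X 6) = z at *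
  rw [show -2 * a + 3 * b + 3 * c - w - x - y - z = 4 * (b + c) - a by linear_combination -h1,
    key]
  ring
end

section
/- In the quotient ring ℚ[x₁,x₂,x₃,x₄]/⟨e₁,e₂,e₃,e₄⟩, where e_k = x₁^k + x₂^k + x₃^k + x₄^k, one has (3x₁ + x₂ − x₃ − 3x₄)⁶ = 1920 · ∏_{1≤i<j≤4} (xᵢ − xⱼ). -/
open MvPolynomial

/-- The ideal `⟨e₁,…,e₄⟩` of power sums in `ℚ[x₁,…,x₄]`. -/
noncomputable def powerSumIdeal4 : Ideal (MvPolynomial (Fin 4) ℚ) :=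
  Ideal.span (Set.range fun k : Fin 4 => ∑ i, X i ^ (k.val + 1))

/-- When the first four power sums of `a, b, c, d` vanish in a `ℚ`-algebra, the sixth power of
`3a + b - c - 3d` is `1920` times the Vandermonde product. -/
theorem pow_six_eq_vandermonde_of_power_sums_eq_zero {R : Type*} [CommRing R] [Algebra ℚ R]
    {a b c d : R} (h₁ : a + b + c + d = 0) (h₂ : a ^ 2 + b ^ 2 + c ^ 2 + d ^ 2 = 0)
    (h₃ : a ^ 3 + b ^ 3 + c ^ 3 + d ^ 3 = 0) (h₄ : a ^ 4 + b ^ 4 + c ^ 4 + d ^ 4 = 0) :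
    (3 * a + b - c - 3 * d) ^ 6 =
      1920 * ((a - b) * (a - c) * (a - d) * (b - c) * (b - d) * (c - d)) := by
  have cancel (n : ℕ) (hn : n ≠ 0) (x : R) (hx : (n : R) * x = 0) : x = 0 := by
    have : (n : ℚ) • x = 0 := by simpa [Algebra.smul_def] using hx
    exact (smul_eq_zero_iff_right (Nat.cast_ne_zero.mpr hn)).mp this
  obtain rfl : a = -b - c - d := by linear_combination h₁
  have h₂' : b ^ 2 + c ^ 2 + d ^ 2 + b * c + b * d + c * d = 0 :=
    cancel 2 (by simp) _ (by push_cast; linear_combination h₂)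
  have h₃' : c ^ 3 + c ^ 2 * d + c * d ^ 2 + d ^ 3 = 0 :=
    cancel 3 (by simp) _ (by push_cast; grind)
  have h₄' : d ^ 4 = 0 := cancel 4 (by simp) _ (by push_cast; grind)
  clear h₁ h₂ h₃ h₄ cancel
  grind

/-- In `ℚ[x₁,…,x₄]/⟨e₁,…,e₄⟩`, the Chern number identity
`(3x₁+x₂−x₃−3x₄)⁶ = 1920·∏_{i<j}(xᵢ−xⱼ)` for the canonical invariant complex structure
on the full flag manifold `SU(4)/T`. -/
theorem chern_number_F4_full :
    Ideal.Quotient.mk powerSumIdeal4 ((3 * X 0 + X 1 - X 2 - 3 * X 3) ^ 6) =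
      Ideal.Quotient.mk powerSumIdeal4
        (1920 * ((X 0 - X 1) * (X 0 - X 2) * (X 0 - X 3) *
          (X 1 - X 2) * (X 1 - X 3) * (X 2 - X 3))) := by
  have power_sum (k : Fin 4) :
      Ideal.Quotient.mk powerSumIdeal4 (∑ i, X i ^ (k.val + 1)) = 0 :=
    Ideal.Quotient.eq_zero_iff_mem.mpr (Ideal.subset_span ⟨k, rfl⟩)
  simp only [map_mul, map_sub, map_add, map_pow, map_ofNat]
  apply pow_six_eq_vandermonde_of_power_sums_eq_zero
  · simpa [Fin.sum_univ_four] using power_sum 0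
  · simpa [Fin.sum_univ_four] using power_sum 1
  · simpa [Fin.sum_univ_four] using power_sum 2
  · simpa [Fin.sum_univ_four] using power_sum 3
end

section
/- In the quotient ring ℚ[x₁,…,x₅]/⟨e₁,…,e₅⟩, where e_k = x₁^k + ⋯ + x₅^k, one has (4x₁ + 2x₂ − 2x₄ − 4x₅)¹⁰ = 30965760 · ∏_{1≤i<j≤5} (xᵢ − xⱼ). -/
open MvPolynomial

/-- The ideal `⟨e₁,…,e₅⟩` of power sums in `ℚ[x₁,…,x₅]`. -/
noncomputable def powerSumIdeal5 : Ideal (MvPolynomial (Fin 5) ℚ) :=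
  Ideal.span (Set.range fun k : Fin 5 => ∑ i, X i ^ (k.val + 1))

/-- The tenth power of `4a+3b+2c+d` modulo the complete homogeneous relations
`h₂(a,b,c,d) = h₃(a,b,c) = h₄(a,b) = h₅(a) = 0` of the complete flag manifold. -/
theorem flag_linear_form_pow_ten {R : Type*} [CommRing R] {a b c d : R}
    (hd : a ^ 2 + a * b + a * c + a * d + b ^ 2 + b * c + b * d + c ^ 2 + c * d + d ^ 2 = 0)
    (hc : a ^ 3 + a ^ 2 * b + a ^ 2 * c + a * b ^ 2 + a * b * c + a * c ^ 2 + b ^ 3 + b ^ 2 * c +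
      b * c ^ 2 + c ^ 3 = 0)
    (hb : a ^ 4 + a ^ 3 * b + a ^ 2 * b ^ 2 + a * b ^ 3 + b ^ 4 = 0)
    (ha : a ^ 5 = 0) :
    (4 * a + 3 * b + 2 * c + d) ^ 10 = 3628800 * (a ^ 4 * b ^ 3 * c ^ 2 * d) := by
  have h2 : (4 * a + 3 * b + 2 * c + d) ^ 2 = 15 * a ^ 2 + 23 * a * b + 15 * a * c + 7 * a * d +
    8 * b ^ 2 + 11 * b * c + 5 * b * d + 3 * c ^ 2 + 3 * c * d := by
    linear_combination hd
  have h3 : (4 * a + 3 * b + 2 * c + d) ^ 3 = 50 * a ^ 3 + 122 * a ^ 2 * b + 77 * a ^ 2 * c +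
    36 * a ^ 2 * d + 86 * a * b ^ 2 + 117 * a * b * c + 52 * a * b * d + 29 * a * c ^ 2 +
    31 * a * c * d + 16 * b ^ 3 + 38 * b ^ 2 * c + 18 * b ^ 2 * d + 20 * b * c ^ 2 +
    22 * b * c * d + 6 * c ^ 2 * d := by
    linear_combination (7 * a + 5 * b + 3 * c) * hd + 3 * hc + (4 * a + 3 * b + 2 * c + d) * h2
  have h4 : (4 * a + 3 * b + 2 * c + d) ^ 4 = 125 * a ^ 4 + 493 * a ^ 3 * b + 320 * a ^ 3 * c +
    152 * a ^ 3 * d + 547 * a ^ 2 * b ^ 2 + 763 * a ^ 2 * b * c + 344 * a ^ 2 * b * d +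
    176 * a ^ 2 * c ^ 2 + 200 * a ^ 2 * c * d + 195 * a * b ^ 3 + 513 * a * b ^ 2 * c +
    238 * a * b ^ 2 * d + 251 * a * b * c ^ 2 + 291 * a * b * c * d + 72 * a * c ^ 2 * d +
    94 * b ^ 3 * c + 46 * b ^ 3 * d + 78 * b ^ 2 * c ^ 2 + 94 * b ^ 2 * c * d + 48 * b * c ^ 2 * d
    := by
    linear_combination (36 * a ^ 2 + 52 * a * b + 31 * a * c + 18 * b ^ 2 + 22 * b * c +
      6 * c ^ 2) * hd + (27 * a + 18 * b - 6 * c + 6 * d) * hc + 12 * hb + (4 * a + 3 * b +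
      2 * c + d) * h3
  have h5 : (4 * a + 3 * b + 2 * c + d) ^ 5 = 1460 * a ^ 4 * b + 970 * a ^ 4 * c + 465 * a ^ 4 * d +
    2480 * a ^ 3 * b ^ 2 + 3640 * a ^ 3 * b * c + 1665 * a ^ 3 * b * d + 840 * a ^ 3 * c ^ 2 +
    1000 * a ^ 3 * c * d + 1340 * a ^ 2 * b ^ 3 + 3835 * a ^ 2 * b ^ 2 * c +
    1785 * a ^ 2 * b ^ 2 * d + 1860 * a ^ 2 * b * c ^ 2 + 2260 * a ^ 2 * b * c * d +
    520 * a ^ 2 * c ^ 2 * d + 1355 * a * b ^ 3 * c + 645 * a * b ^ 3 * d +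
    1195 * a * b ^ 2 * c ^ 2 + 1495 * a * b ^ 2 * c * d + 710 * a * b * c ^ 2 * d +
    220 * b ^ 3 * c ^ 2 + 280 * b ^ 3 * c * d + 220 * b ^ 2 * c ^ 2 * d := by
    linear_combination (152 * a ^ 3 + 344 * a ^ 2 * b + 200 * a ^ 2 * c + 238 * a * b ^ 2 +
      291 * a * b * c + 72 * a * c ^ 2 + 46 * b ^ 3 + 94 * b ^ 2 * c + 48 * b * c ^ 2) * hd +
      (152 * a ^ 2 + 211 * a * b - 72 * a * c + 72 * a * d + 62 * b ^ 2 - 48 * b * c +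
      48 * b * d) * hc + (136 * a - 108 * b + 128 * c + 44 * d) * hb + 60 * ha + (4 * a + 3 * b +
      2 * c + d) * h4
  have h6 : (4 * a + 3 * b + 2 * c + d) ^ 6 = 8275 * a ^ 4 * b ^ 2 + 12570 * a ^ 4 * b * c +
    5795 * a ^ 4 * b * d + 2935 * a ^ 4 * c ^ 2 + 3575 * a ^ 4 * c * d + 6435 * a ^ 3 * b ^ 3 +
    19910 * a ^ 3 * b ^ 2 * c + 9355 * a ^ 3 * b ^ 2 * d + 9955 * a ^ 3 * b * c ^ 2 +
    12515 * a ^ 3 * b * c * d + 2880 * a ^ 3 * c ^ 2 * d + 10555 * a ^ 2 * b ^ 3 * c +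
    5035 * a ^ 2 * b ^ 3 * d + 9915 * a ^ 2 * b ^ 2 * c ^ 2 + 12835 * a ^ 2 * b ^ 2 * c * d +
    6060 * a ^ 2 * b * c ^ 2 * d + 3480 * a * b ^ 3 * c ^ 2 + 4560 * a * b ^ 3 * c * d +
    3840 * a * b ^ 2 * c ^ 2 * d + 720 * b ^ 3 * c ^ 2 * d := by
    linear_combination (465 * a ^ 4 + 1665 * a ^ 3 * b + 1000 * a ^ 3 * c + 1785 * a ^ 2 * b ^ 2 +
      2260 * a ^ 2 * b * c + 520 * a ^ 2 * c ^ 2 + 645 * a * b ^ 3 + 1495 * a * b ^ 2 * c +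
      710 * a * b * c ^ 2 + 280 * b ^ 3 * c + 220 * b ^ 2 * c ^ 2) * hd + (680 * a ^ 3 +
      1460 * a ^ 2 * b - 520 * a ^ 2 * c + 520 * a ^ 2 * d + 895 * a * b ^ 2 - 710 * a * b * c +
      710 * a * b * d + 160 * b ^ 3 - 220 * b ^ 2 * c + 220 * b ^ 2 * d) * hc + (775 * a ^ 2 -
      1540 * a * b + 1740 * a * c + 580 * a * d - 160 * b ^ 2 - 220 * b * c - 220 * b * d +
      220 * c ^ 2 + 340 * c * d) * hb + (-1920 * a + 2335 * b + 515 * c + 295 * d) * ha + (4 * a +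
      3 * b + 2 * c + d) * h5
  have h7 : (4 * a + 3 * b + 2 * c + d) ^ 7 = 23170 * a ^ 4 * b ^ 3 + 75460 * a ^ 4 * b ^ 2 * c +
    35700 * a ^ 4 * b ^ 2 * d + 38710 * a ^ 4 * b * c ^ 2 + 49560 * a ^ 4 * b * c * d +
    11550 * a ^ 4 * c ^ 2 * d + 56770 * a ^ 3 * b ^ 3 * c + 27300 * a ^ 3 * b ^ 3 * d +
    56770 * a ^ 3 * b ^ 2 * c ^ 2 + 75460 * a ^ 3 * b ^ 2 * c * d + 36750 * a ^ 3 * b * c ^ 2 * d +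
    29470 * a ^ 2 * b ^ 3 * c ^ 2 + 39760 * a ^ 2 * b ^ 3 * c * d +
    35770 * a ^ 2 * b ^ 2 * c ^ 2 * d + 12600 * a * b ^ 3 * c ^ 2 * d := by
    linear_combination (5795 * a ^ 4 * b + 3575 * a ^ 4 * c + 9355 * a ^ 3 * b ^ 2 +
      12515 * a ^ 3 * b * c + 2880 * a ^ 3 * c ^ 2 + 5035 * a ^ 2 * b ^ 3 +
      12835 * a ^ 2 * b ^ 2 * c + 6060 * a ^ 2 * b * c ^ 2 + 4560 * a * b ^ 3 * c +
      3840 * a * b ^ 2 * c ^ 2 + 720 * b ^ 3 * c ^ 2) * hd + (2295 * a ^ 4 + 7395 * a ^ 3 * b -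
      2880 * a ^ 3 * c + 2880 * a ^ 3 * d + 6995 * a ^ 2 * b ^ 2 - 6060 * a ^ 2 * b * c +
      6060 * a ^ 2 * b * d + 2400 * a * b ^ 3 - 3840 * a * b ^ 2 * c + 3840 * a * b ^ 2 * d -
      720 * b ^ 3 * c + 720 * b ^ 3 * d) * hc + (2555 * a ^ 3 - 12030 * a ^ 2 * b +
      12860 * a ^ 2 * c + 4010 * a ^ 2 * d - 2400 * a * b ^ 2 - 3120 * a * b * c -
      3840 * a * b * d + 3480 * a * c ^ 2 + 5280 * a * c * d + 720 * b ^ 2 * c - 720 * b ^ 2 * d -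
      720 * b * c * d + 720 * c ^ 2 * d) * hb + (-4850 * a ^ 2 - 6010 * a * b - 15850 * a * c -
      6890 * a * d + 13140 * b ^ 2 + 17905 * b * c + 8275 * b * d + 2390 * c ^ 2 +
      2565 * c * d) * ha + (4 * a + 3 * b + 2 * c + d) * h6
  have h8 : (4 * a + 3 * b + 2 * c + d) ^ 8 = 227920 * a ^ 4 * b ^ 3 * c +
    110320 * a ^ 4 * b ^ 3 * d + 238000 * a ^ 4 * b ^ 2 * c ^ 2 + 321440 * a ^ 4 * b ^ 2 * c * d +
    160720 * a ^ 4 * b * c ^ 2 * d + 172480 * a ^ 3 * b ^ 3 * c ^ 2 +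
    238000 * a ^ 3 * b ^ 3 * c * d + 227920 * a ^ 3 * b ^ 2 * c ^ 2 * d +
    117600 * a ^ 2 * b ^ 3 * c ^ 2 * d := by
    linear_combination (35700 * a ^ 4 * b ^ 2 + 49560 * a ^ 4 * b * c + 11550 * a ^ 4 * c ^ 2 +
      27300 * a ^ 3 * b ^ 3 + 75460 * a ^ 3 * b ^ 2 * c + 36750 * a ^ 3 * b * c ^ 2 +
      39760 * a ^ 2 * b ^ 3 * c + 35770 * a ^ 2 * b ^ 2 * c ^ 2 + 12600 * a * b ^ 3 * c ^ 2) * hd +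
      (27860 * a ^ 4 * b - 11550 * a ^ 4 * c + 11550 * a ^ 4 * d + 38080 * a ^ 3 * b ^ 2 -
      36750 * a ^ 3 * b * c + 36750 * a ^ 3 * b * d + 19180 * a ^ 2 * b ^ 3 -
      35770 * a ^ 2 * b ^ 2 * c + 35770 * a ^ 2 * b ^ 2 * d - 12600 * a * b ^ 3 * c +
      12600 * a * b ^ 3 * d) * hc + (5950 * a ^ 4 - 65380 * a ^ 3 * b + 66220 * a ^ 3 * c +
      17850 * a ^ 3 * d - 19180 * a ^ 2 * b ^ 2 - 23170 * a ^ 2 * b * c - 35770 * a ^ 2 * b * d +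
      29470 * a ^ 2 * c ^ 2 + 43750 * a ^ 2 * c * d + 12600 * a * b ^ 2 * c -
      12600 * a * b ^ 2 * d - 12600 * a * b * c * d + 12600 * a * c ^ 2 * d) * hb + (-5950 * a ^ 3 +
      31570 * a ^ 2 * b - 54670 * a ^ 2 * c - 29400 * a ^ 2 * d - 23030 * a * b ^ 2 -
      72170 * a * b * c - 30380 * a * b * d - 29470 * a * c ^ 2 - 55300 * a * c * d +
      23170 * b ^ 3 + 103600 * b ^ 2 * c + 53550 * b ^ 2 * d + 47950 * b * c ^ 2 +
      69230 * b * c * d + 10500 * c ^ 2 * d) * ha + (4 * a + 3 * b + 2 * c + d) * h7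
  have h9 : (4 * a + 3 * b + 2 * c + d) ^ 9 = 756000 * a ^ 4 * b ^ 3 * c ^ 2 +
    1058400 * a ^ 4 * b ^ 3 * c * d + 1058400 * a ^ 4 * b ^ 2 * c ^ 2 * d +
    756000 * a ^ 3 * b ^ 3 * c ^ 2 * d := by
    linear_combination (110320 * a ^ 4 * b ^ 3 + 321440 * a ^ 4 * b ^ 2 * c +
      160720 * a ^ 4 * b * c ^ 2 + 238000 * a ^ 3 * b ^ 3 * c + 227920 * a ^ 3 * b ^ 2 * c ^ 2 +
      117600 * a ^ 2 * b ^ 3 * c ^ 2) * hd + (154560 * a ^ 4 * b ^ 2 - 160720 * a ^ 4 * b * c +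
      160720 * a ^ 4 * b * d + 106960 * a ^ 3 * b ^ 3 - 227920 * a ^ 3 * b ^ 2 * c +
      227920 * a ^ 3 * b ^ 2 * d - 117600 * a ^ 2 * b ^ 3 * c + 117600 * a ^ 2 * b ^ 3 * d) * hc +
      (-264880 * a ^ 4 * b + 258160 * a ^ 4 * c + 59920 * a ^ 4 * d - 106960 * a ^ 3 * b ^ 2 -
      117040 * a ^ 3 * b * c - 227920 * a ^ 3 * b * d + 172480 * a ^ 3 * c ^ 2 +
      248080 * a ^ 3 * c * d + 117600 * a ^ 2 * b ^ 2 * c - 117600 * a ^ 2 * b ^ 2 * d -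
      117600 * a ^ 2 * b * c * d + 117600 * a ^ 2 * c ^ 2 * d) * hb + (264880 * a ^ 3 * b -
      258160 * a ^ 3 * c - 59920 * a ^ 3 * d + 217280 * a ^ 2 * b ^ 2 + 19600 * a ^ 2 * b * c +
      7280 * a ^ 2 * b * d - 172480 * a ^ 2 * c ^ 2 - 248080 * a ^ 2 * c * d -
      346080 * a * b ^ 2 * c - 103040 * a * b ^ 2 * d - 172480 * a * b * c ^ 2 -
      291200 * a * b * c * d - 117600 * a * c ^ 2 * d + 227920 * b ^ 3 * c + 110320 * b ^ 3 * d +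
      303520 * b ^ 2 * c ^ 2 + 445200 * b ^ 2 * c * d + 203840 * b * c ^ 2 * d) * ha + (4 * a +
      3 * b + 2 * c + d) * h8
  linear_combination (1058400 * a ^ 4 * b ^ 3 * c + 1058400 * a ^ 4 * b ^ 2 * c ^ 2 +
    756000 * a ^ 3 * b ^ 3 * c ^ 2) * hd + (453600 * a ^ 4 * b ^ 3 - 1058400 * a ^ 4 * b ^ 2 * c +
    1058400 * a ^ 4 * b ^ 2 * d - 756000 * a ^ 3 * b ^ 3 * c + 756000 * a ^ 3 * b ^ 3 * d) * hc +
    (-453600 * a ^ 4 * b ^ 2 - 453600 * a ^ 4 * b * c - 1058400 * a ^ 4 * b * d +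
    756000 * a ^ 4 * c ^ 2 + 1058400 * a ^ 4 * c * d + 756000 * a ^ 3 * b ^ 2 * c -
    756000 * a ^ 3 * b ^ 2 * d - 756000 * a ^ 3 * b * c * d + 756000 * a ^ 3 * c ^ 2 * d) * hb +
    (453600 * a ^ 3 * b ^ 2 + 453600 * a ^ 3 * b * c + 1058400 * a ^ 3 * b * d -
    756000 * a ^ 3 * c ^ 2 - 1058400 * a ^ 3 * c * d + 756000 * a ^ 2 * b ^ 2 * c +
    756000 * a ^ 2 * b ^ 2 * d - 756000 * a ^ 2 * b * c ^ 2 - 302400 * a ^ 2 * b * c * d -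
    756000 * a ^ 2 * c ^ 2 * d - 756000 * a * b ^ 2 * c ^ 2 - 1360800 * a * b ^ 2 * c * d -
    756000 * a * b * c ^ 2 * d + 756000 * b ^ 3 * c ^ 2 + 1058400 * b ^ 3 * c * d +
    1360800 * b ^ 2 * c ^ 2 * d) * ha + (4 * a + 3 * b + 2 * c + d) * h9

/-- The Vandermonde product modulo the complete homogeneous relations of the complete flag
manifold. -/
theorem flag_vandermonde {R : Type*} [CommRing R] {a b c d e : R}
    (he : a + b + c + d + e = 0)
    (hd : a ^ 2 + a * b + a * c + a * d + b ^ 2 + b * c + b * d + c ^ 2 + c * d + d ^ 2 = 0)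
    (hc : a ^ 3 + a ^ 2 * b + a ^ 2 * c + a * b ^ 2 + a * b * c + a * c ^ 2 + b ^ 3 + b ^ 2 * c +
      b * c ^ 2 + c ^ 3 = 0)
    (hb : a ^ 4 + a ^ 3 * b + a ^ 2 * b ^ 2 + a * b ^ 3 + b ^ 4 = 0)
    (ha : a ^ 5 = 0) :
    (a - b) * (a - c) * (a - d) * (a - e) * (b - c) * (b - d) * (b - e) *
      (c - d) * (c - e) * (d - e) = 120 * (a ^ 4 * b ^ 3 * c ^ 2 * d) := by
  obtain rfl : e = -(a + b + c + d) := by linear_combination he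
  have h₁ : (a - b) * (a - c) * (a - d) * (a - -(a + b + c + d)) = 5 * a ^ 4 := by
    linear_combination (-a ^ 2 + a * b + a * c - b * c) * hd + (-a + b) * hc - hb
  have h₂ : a ^ 4 * ((b - c) * (b - d) * (b - -(a + b + c + d))) = 4 * (a ^ 4 * b ^ 3) := by
    linear_combination (-a ^ 4 * b + a ^ 4 * c) * hd - a ^ 4 * hc +
      (a ^ 2 + 2 * a * b + 3 * b ^ 2) * ha
  have h₃ : a ^ 4 * b ^ 3 * ((c - d) * (c - -(a + b + c + d))) =
      3 * (a ^ 4 * b ^ 3 * c ^ 2) := by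
    linear_combination -a ^ 4 * b ^ 3 * hd + (a ^ 4 * b + 2 * a ^ 4 * c) * hb +
      (-a ^ 3 * b - 2 * a ^ 3 * c - a ^ 2 * b ^ 2 - 2 * a ^ 2 * b * c - 2 * a * b ^ 2 * c) * ha
  have h₄ : a ^ 4 * b ^ 3 * c ^ 2 * (d - -(a + b + c + d)) =
      2 * (a ^ 4 * b ^ 3 * c ^ 2 * d) := by
    linear_combination a ^ 4 * b ^ 3 * hc + (-a ^ 4 * b ^ 2 - a ^ 4 * b * c) * hb +
      (a ^ 3 * b ^ 2 + a ^ 3 * b * c + a ^ 2 * b ^ 2 * c) * ha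
  generalize -(a + b + c + d) = e at *
  linear_combination ((b - c) * (b - d) * (b - e) * (c - d) * (c - e) * (d - e)) * h₁ +
    5 * ((c - d) * (c - e) * (d - e)) * h₂ + 20 * (d - e) * h₃ + 60 * h₄

/-- Over `ℚ`, vanishing of the first five power sums of five elements implies the complete
homogeneous relations of the complete flag manifold. -/
theorem flag_relations_of_power_sums {R : Type*} [CommRing R] [Algebra ℚ R] {a b c d e : R}
    (h₁ : a + b + c + d + e = 0)
    (h₂ : a ^ 2 + b ^ 2 + c ^ 2 + d ^ 2 + e ^ 2 = 0)
    (h₃ : a ^ 3 + b ^ 3 + c ^ 3 + d ^ 3 + e ^ 3 = 0)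
    (h₄ : a ^ 4 + b ^ 4 + c ^ 4 + d ^ 4 + e ^ 4 = 0)
    (h₅ : a ^ 5 + b ^ 5 + c ^ 5 + d ^ 5 + e ^ 5 = 0) :
    a ^ 2 + a * b + a * c + a * d + b ^ 2 + b * c + b * d + c ^ 2 + c * d + d ^ 2 = 0 ∧
    a ^ 3 + a ^ 2 * b + a ^ 2 * c + a * b ^ 2 + a * b * c + a * c ^ 2 + b ^ 3 + b ^ 2 * c +
      b * c ^ 2 + c ^ 3 = 0 ∧
    a ^ 4 + a ^ 3 * b + a ^ 2 * b ^ 2 + a * b ^ 3 + b ^ 4 = 0 ∧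
    a ^ 5 = 0 := by
  obtain rfl : e = -(a + b + c + d) := by linear_combination h₁
  have cancel {n : ℕ} {r : R} (hn : n ≠ 0) (h : (n : R) * r = 0) : r = 0 := by
    rw [← map_natCast (algebraMap ℚ R), ← Algebra.smul_def] at h
    exact (smul_eq_zero.mp h).resolve_left (by exact_mod_cast hn)
  have hd : a ^ 2 + a * b + a * c + a * d + b ^ 2 + b * c + b * d + c ^ 2 + c * d + d ^ 2 = 0 := by
    refine cancel two_ne_zero ?_
    push_cast
    linear_combination h₂
  have hc : a ^ 3 + a ^ 2 * b + a ^ 2 * c + a * b ^ 2 + a * b * c + a * c ^ 2 + b ^ 3 +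
      b ^ 2 * c + b * c ^ 2 + c ^ 3 = 0 := by
    refine cancel three_ne_zero ?_
    push_cast
    linear_combination h₃ + 3 * (a + b + c) * hd
  have hb : a ^ 4 + a ^ 3 * b + a ^ 2 * b ^ 2 + a * b ^ 3 + b ^ 4 = 0 := by
    refine cancel four_ne_zero ?_
    push_cast
    linear_combination h₄ + 4 * (a + b) * hc - 2 * (a ^ 2 + 3 * a * b + 3 * a * c + a * d +
      b ^ 2 + 3 * b * c + b * d + c ^ 2 + c * d + d ^ 2) * hd
  refine ⟨hd, hc, hb, cancel (n := 5) (by norm_num) ?_⟩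
  push_cast
  linear_combination h₅ + 5 * a * hb - 5 * a * b * hc +
    5 * (a ^ 2 * b + a ^ 2 * c + a ^ 2 * d + a * b ^ 2 + 3 * a * b * c + 2 * a * b * d +
      a * c ^ 2 + 2 * a * c * d + a * d ^ 2 + b ^ 2 * c + b ^ 2 * d + b * c ^ 2 +
      2 * b * c * d + b * d ^ 2 + c ^ 2 * d + c * d ^ 2) * hd

/-- In `ℚ[x₁,…,x₅]/⟨e₁,…,e₅⟩`, the Chern number identity
`(4x₁+2x₂−2x₄−4x₅)¹⁰ = 30965760·∏_{i<j}(xᵢ−xⱼ)` for the canonical invariant complex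
structure on the full flag manifold `SU(5)/T`. -/
theorem chern_number_F5_full :
    Ideal.Quotient.mk powerSumIdeal5 ((4 * X 0 + 2 * X 1 - 2 * X 3 - 4 * X 4) ^ 10) =
      Ideal.Quotient.mk powerSumIdeal5
        (30965760 * ((X 0 - X 1) * (X 0 - X 2) * (X 0 - X 3) * (X 0 - X 4) *
          (X 1 - X 2) * (X 1 - X 3) * (X 1 - X 4) *
          (X 2 - X 3) * (X 2 - X 4) * (X 3 - X 4))) := by
  have hp (k : Fin 5) :
      ∑ i, Ideal.Quotient.mk powerSumIdeal5 (X i) ^ (k.val + 1) = 0 := by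
    simp only [← map_pow, ← map_sum]
    exact Ideal.Quotient.eq_zero_iff_mem.mpr (Ideal.subset_span ⟨k, rfl⟩)
  simp only [map_mul, map_pow, map_sub, map_add, map_ofNat]
  generalize Ideal.Quotient.mk powerSumIdeal5 = f at *
  have h₁ := hp 0
  have h₂ := hp 1
  have h₃ := hp 2
  have h₄ := hp 3
  have h₅ := hp 4
  simp [Fin.sum_univ_five] at h₁ h₂ h₃ h₄ h₅
  obtain ⟨hd, hc, hb, ha⟩ := flag_relations_of_power_sums h₁ h₂ h₃ h₄ h₅
  have hL : 4 * f (X 0) + 2 * f (X 1) - 2 * f (X 3) - 4 * f (X 4) =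
      2 * (4 * f (X 0) + 3 * f (X 1) + 2 * f (X 2) + f (X 3)) := by
    linear_combination -4 * h₁
  rw [hL, mul_pow, flag_linear_form_pow_ten hd hc hb ha, flag_vandermonde h₁ hd hc hb ha]
  ring
end

section
/- In the quotient ring ℚ[x,y,z,w]/⟨x²+y²+z²+w², x⁴+y⁴+z⁴+w⁴, x⁶+y⁶+z⁶+w⁶, xyzw⟩ one has (x+y+z+w)⁶ = 16·(x+y)(x+z)(x+w)(y+z)(y+w)(z+w). -/
open MvPolynomial

/-- The ideal `⟨s₁,s₂,s₃,e₄⟩ = ⟨x²+y²+z²+w², x⁴+y⁴+z⁴+w⁴, x⁶+y⁶+z⁶+w⁶, xyzw⟩`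
of `ℚ[x,y,z,w]` presenting the cohomology of `SO(8)/U(4)`. -/
noncomputable def idealSO8 : Ideal (MvPolynomial (Fin 4) ℚ) :=
  Ideal.span {X 0 ^ 2 + X 1 ^ 2 + X 2 ^ 2 + X 3 ^ 2,
    X 0 ^ 4 + X 1 ^ 4 + X 2 ^ 4 + X 3 ^ 4,
    X 0 ^ 6 + X 1 ^ 6 + X 2 ^ 6 + X 3 ^ 6,
    X 0 * X 1 * X 2 * X 3}

/-- If the power sums of degrees 2, 4, 6 of `x, y, z, w` and their product vanish, then
`(x+y+z+w)⁶ = 16·(x+y)(x+z)(x+w)(y+z)(y+w)(z+w)`, provided `3` is invertible. -/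
theorem sum_pow_six_eq_of_power_sums_eq_zero {R : Type*} [CommRing R] (h3 : IsUnit (3 : R))
    {x y z w : R} (h₁ : x ^ 2 + y ^ 2 + z ^ 2 + w ^ 2 = 0)
    (h₂ : x ^ 4 + y ^ 4 + z ^ 4 + w ^ 4 = 0) (h₃ : x ^ 6 + y ^ 6 + z ^ 6 + w ^ 6 = 0)
    (h₄ : x * y * z * w = 0) :
    (x + y + z + w) ^ 6 =
      16 * ((x + y) * (x + z) * (x + w) * (y + z) * (y + w) * (z + w)) := by
  obtain ⟨a, ha⟩ : ∃ a, a = x + y + z + w := ⟨_, rfl⟩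
  obtain ⟨b, hb⟩ : ∃ b, b = x * y + x * z + x * w + y * z + y * w + z * w := ⟨_, rfl⟩
  obtain ⟨p, hp⟩ : ∃ p, p = x ^ 2 + y ^ 2 + z ^ 2 + w ^ 2 := ⟨_, rfl⟩
  have h : 3 * (x + y + z + w) ^ 6 -
        3 * (16 * ((x + y) * (x + z) * (x + w) * (y + z) * (y + w) * (z + w))) =
      (3 * (a ^ 4 + 2 * a ^ 2 * b + 4 * b ^ 2) + 12 * b * p + 8 * p ^ 2) * p
        - (12 * b + 24 * p) * (x ^ 4 + y ^ 4 + z ^ 4 + w ^ 4)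
        + 16 * (x ^ 6 + y ^ 6 + z ^ 6 + w ^ 6)
        + 48 * (b + a ^ 2) * (x * y * z * w) := by
    subst ha hb hp
    ring
  rw [h₂, h₃, h₄, hp, h₁] at h
  exact h3.mul_left_cancel (by linear_combination h)

/-- In `ℚ[x,y,z,w]/⟨x²+y²+z²+w², x⁴+y⁴+z⁴+w⁴, x⁶+y⁶+z⁶+w⁶, xyzw⟩`, the Chern number
identity `(x+y+z+w)⁶ = 16·(x+y)(x+z)(x+w)(y+z)(y+w)(z+w)` for `SO(8)/U(4)`. -/
theorem chern_number_SO8_U4 :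
    Ideal.Quotient.mk idealSO8 ((X 0 + X 1 + X 2 + X 3) ^ 6) =
      Ideal.Quotient.mk idealSO8
        (16 * ((X 0 + X 1) * (X 0 + X 2) * (X 0 + X 3) *
          (X 1 + X 2) * (X 1 + X 3) * (X 2 + X 3))) := by
  have mem : ∀ q ∈ ({X 0 ^ 2 + X 1 ^ 2 + X 2 ^ 2 + X 3 ^ 2,
      X 0 ^ 4 + X 1 ^ 4 + X 2 ^ 4 + X 3 ^ 4,
      X 0 ^ 6 + X 1 ^ 6 + X 2 ^ 6 + X 3 ^ 6,
      X 0 * X 1 * X 2 * X 3} : Set (MvPolynomial (Fin 4) ℚ)),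
      Ideal.Quotient.mk idealSO8 q = 0 := fun q hq =>
    Ideal.Quotient.eq_zero_iff_mem.mpr (Ideal.subset_span hq)
  simp only [Set.mem_insert_iff, Set.mem_singleton_iff, forall_eq_or_imp, forall_eq, map_add,
    map_mul, map_pow] at mem
  obtain ⟨h₁, h₂, h₃, h₄⟩ := mem
  have h3 : IsUnit (3 : MvPolynomial (Fin 4) ℚ ⧸ idealSO8) := by
    rw [← map_ofNat (algebraMap ℚ (MvPolynomial (Fin 4) ℚ ⧸ idealSO8)) 3]
    exact (IsUnit.mk0 (3 : ℚ) (by norm_num)).map _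
  simpa only [map_add, map_mul, map_pow, map_ofNat] using
    sum_pow_six_eq_of_power_sums_eq_zero h3 h₁ h₂ h₃ h₄
end

section
/- Let Q be the quotient ring ℚ[x,y]/⟨x²+y², x⁴+y⁴⟩ and set c₁ = 3x+y, c₂ = 3xy−4y², c₃ = −2(xy²+2y³), c₄ = −2xy³ in Q. Then in Q: c₁⁴ = 48·c₄, c₁²·c₂ = 24·c₄, c₂² = 12·c₄, c₁·c₃ = 7·c₄, and c₄ ≠ 0. -/
open MvPolynomial

/-- The ideal `⟨x²+y², x⁴+y⁴⟩` of `ℚ[x,y]` presenting the cohomology of `SO(5)/T`. -/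
noncomputable def idealB2 : Ideal (MvPolynomial (Fin 2) ℚ) :=
  Ideal.span {X 0 ^ 2 + X 1 ^ 2, X 0 ^ 4 + X 1 ^ 4}

/-- The quotient ring `ℚ[x,y]/⟨x²+y², x⁴+y⁴⟩`. -/
noncomputable abbrev QB2 := MvPolynomial (Fin 2) ℚ ⧸ idealB2

/-- The Chern classes of the canonical invariant complex structure on `SO(5)/T`:
`c₁ = 3x+y`, `c₂ = 3xy−4y²`, `c₃ = −2(xy²+2y³)`, `c₄ = −2xy³`. -/
noncomputable def cB2 : Fin 4 → QB2
  | 0 => Ideal.Quotient.mk idealB2 (3 * X 0 + X 1)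
  | 1 => Ideal.Quotient.mk idealB2 (3 * (X 0 * X 1) - 4 * X 1 ^ 2)
  | 2 => Ideal.Quotient.mk idealB2 (-2 * (X 0 * X 1 ^ 2 + 2 * X 1 ^ 3))
  | 3 => Ideal.Quotient.mk idealB2 (-2 * (X 0 * X 1 ^ 3))

/-- The functional `p ↦ [x y³] p - [x³ y] p` vanishes on `⟨x²+y², x⁴+y⁴⟩`. -/
theorem coeff_eq_of_mem_idealB2 {p : MvPolynomial (Fin 2) ℚ} (hp : p ∈ idealB2) :
    coeff (Finsupp.single 0 1 + Finsupp.single 1 3) p =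
      coeff (Finsupp.single 0 3 + Finsupp.single 1 1) p := by
  obtain ⟨a, b, rfl⟩ := Ideal.mem_span_pair.1 hp
  have e₁ : (Finsupp.single 0 1 + Finsupp.single 1 3 - Finsupp.single 1 2 : Fin 2 →₀ ℕ) =
      Finsupp.single 0 3 + Finsupp.single 1 1 - Finsupp.single 0 2 := by
    ext i
    fin_cases i <;> simp
  simp only [X_pow_eq_monomial, mul_add, coeff_add, coeff_mul_monomial', e₁]
  simp [Finsupp.le_def, Fin.forall_fin_two]

theorem X_mul_X_pow_three_notMem_idealB2 : -2 * (X 0 * X 1 ^ 3) ∉ idealB2 := by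
  intro h
  have h₁ := coeff_eq_of_mem_idealB2 h
  have e : (-2 * (X 0 * X 1 ^ 3) : MvPolynomial (Fin 2) ℚ) =
      monomial (Finsupp.single 0 1 + Finsupp.single 1 3) (-2) := by
    rw [← mul_one (-2 : ℚ), ← C_mul_monomial, ← one_mul (1 : ℚ), ← monomial_mul,
      ← X_pow_eq_monomial, ← X_pow_eq_monomial, map_neg, map_ofNat, pow_one]
  rw [e, coeff_monomial, coeff_monomial, if_pos rfl, if_neg] at h₁
  · norm_num at h₁
  · intro h₂
    simpa using DFunLike.congr_fun h₂ 0

/-- In `ℚ[x,y]/⟨x²+y², x⁴+y⁴⟩`, the Chern classes of `SO(5)/T` satisfy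
`c₁⁴ = 48·c₄`, `c₁²c₂ = 24·c₄`, `c₂² = 12·c₄`, `c₁c₃ = 7·c₄` and `c₄ ≠ 0`. -/
theorem chern_numbers_SO5_T :
    cB2 0 ^ 4 = 48 * cB2 3 ∧
    cB2 0 ^ 2 * cB2 1 = 24 * cB2 3 ∧
    cB2 1 ^ 2 = 12 * cB2 3 ∧
    cB2 0 * cB2 2 = 7 * cB2 3 ∧
    cB2 3 ≠ 0 := by
  have h₁ : Ideal.Quotient.mk idealB2 (X 0) ^ 2 + Ideal.Quotient.mk idealB2 (X 1) ^ 2 = 0 := by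
    rw [← map_pow, ← map_pow, ← map_add, Ideal.Quotient.eq_zero_iff_mem]
    exact Ideal.subset_span (by simp)
  have h₂ : Ideal.Quotient.mk idealB2 (X 0) ^ 4 + Ideal.Quotient.mk idealB2 (X 1) ^ 4 = 0 := by
    rw [← map_pow, ← map_pow, ← map_add, Ideal.Quotient.eq_zero_iff_mem]
    exact Ideal.subset_span (by simp)
  have h₃ : cB2 3 ≠ 0 := fun h =>
    X_mul_X_pow_three_notMem_idealB2 (Ideal.Quotient.eq_zero_iff_mem.1 h)
  have half : (2 : QB2) * algebraMap ℚ QB2 (1 / 2) = 1 := by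
    rw [← map_ofNat (algebraMap ℚ QB2) 2, ← map_mul]
    norm_num
  simp only [cB2, map_add, map_sub, map_mul, map_neg, map_pow, map_ofNat] at h₃ ⊢
  generalize Ideal.Quotient.mk idealB2 (X 0) = x at *
  generalize Ideal.Quotient.mk idealB2 (X 1) = y at *
  generalize algebraMap ℚ QB2 (1 / 2) = r at *
  have hy : y ^ 4 = 0 := by
    linear_combination r * h₂ - r * (x ^ 2 - y ^ 2) * h₁ - y ^ 4 * half
  have hc₁ : (3 * x + y) ^ 2 = 2 * (3 * (x * y) - 4 * y ^ 2) := by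
    linear_combination 9 * h₁
  have hc₂ : (3 * (x * y) - 4 * y ^ 2) ^ 2 = 12 * (-2 * (x * y ^ 3)) := by
    linear_combination 9 * y ^ 2 * h₁ + 7 * hy
  refine ⟨?_, ?_, hc₂, ?_, h₃⟩
  · linear_combination ((3 * x + y) ^ 2 + 2 * (3 * (x * y) - 4 * y ^ 2)) * hc₁ + 4 * hc₂
  · linear_combination (3 * (x * y) - 4 * y ^ 2) * hc₁ + 2 * hc₂
  · linear_combination -6 * y ^ 2 * h₁ + 2 * hy
end

section
/- Let Q be the quotient ring ℚ[x,y]/⟨x²+y², x⁴+y⁴⟩ and set c₁ = 4x+2y, c₂ = 8xy−6y², c₃ = −4(xy²+3y³), c₄ = −8xy³ in Q. Then in Q: c₁⁴ = 48·c₄, c₁²·c₂ = 24·c₄, c₂² = 12·c₄, c₁·c₃ = 7·c₄, and c₄ ≠ 0. -/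
open MvPolynomial

/-- The ideal `⟨x²+y², x⁴+y⁴⟩` of `ℚ[x,y]` presenting the cohomology of `Sp(2)/T`. -/
noncomputable def idealC2 : Ideal (MvPolynomial (Fin 2) ℚ) :=
  Ideal.span {X 0 ^ 2 + X 1 ^ 2, X 0 ^ 4 + X 1 ^ 4}

/-- The quotient ring `ℚ[x,y]/⟨x²+y², x⁴+y⁴⟩`. -/
noncomputable abbrev QC2 := MvPolynomial (Fin 2) ℚ ⧸ idealC2

/-- The Chern classes of the canonical invariant complex structure on `Sp(2)/T`:
`c₁ = 4x+2y`, `c₂ = 8xy−6y²`, `c₃ = −4(xy²+3y³)`, `c₄ = −8xy³`. -/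
noncomputable def cC2 : Fin 4 → QC2
  | 0 => Ideal.Quotient.mk idealC2 (4 * X 0 + 2 * X 1)
  | 1 => Ideal.Quotient.mk idealC2 (8 * (X 0 * X 1) - 6 * X 1 ^ 2)
  | 2 => Ideal.Quotient.mk idealC2 (-4 * (X 0 * X 1 ^ 2 + 3 * X 1 ^ 3))
  | 3 => Ideal.Quotient.mk idealC2 (-8 * (X 0 * X 1 ^ 3))

/-- If `x y³` vanished modulo `idealC2`, then mapping to the free rank-two extension `x² = -y²`
would make `y⁴ = 0` imply `y³ = 0` in every `ℚ`-algebra. -/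
theorem pow_three_eq_zero_of_mem_idealC2 {A : Type*} [CommRing A] [Algebra ℚ A] {y : A}
    (hy : y ^ 4 = 0) (h : (X 0 * X 1 ^ 3 : MvPolynomial (Fin 2) ℚ) ∈ idealC2) : y ^ 3 = 0 := by
  let v : Fin 2 → QuadraticAlgebra A (-y ^ 2) 0 := ![⟨0, 1⟩, ⟨y, 0⟩]
  let f := eval₂Hom (algebraMap ℚ (QuadraticAlgebra A (-y ^ 2) 0)) v
  have hf0 : f (X 0) = ⟨0, 1⟩ := by simp [f, v]
  have hf1 : f (X 1) = ⟨y, 0⟩ := by simp [f, v]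
  have hle : idealC2 ≤ RingHom.ker f := by
    rw [idealC2, Ideal.span_le]
    have h2 : f (X 0) ^ 2 + f (X 1) ^ 2 = 0 := by
      rw [hf0, hf1]
      ext <;> simp [pow_two]
    have h4 : f (X 1) ^ 4 = 0 := by
      rw [hf1]
      ext
      · simp only [pow_succ, pow_zero, one_mul, QuadraticAlgebra.re_mul, QuadraticAlgebra.im_mul,
          QuadraticAlgebra.re_zero]
        linear_combination hy
      · simp [pow_succ]
    rintro p (rfl | rfl)
    · simpa [RingHom.mem_ker] using h2
    · simp only [SetLike.mem_coe, RingHom.mem_ker, map_add, map_pow]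
      linear_combination (f (X 0) ^ 2 - f (X 1) ^ 2) * h2 + 2 * h4
  have h0 : f (X 0) * f (X 1) ^ 3 = 0 := by
    simpa only [RingHom.mem_ker, map_mul, map_pow] using hle h
  rw [hf0, hf1] at h0
  have him := congrArg QuadraticAlgebra.im h0
  simp only [pow_succ, pow_zero, one_mul, QuadraticAlgebra.re_mul, QuadraticAlgebra.im_mul,
    QuadraticAlgebra.im_zero] at him
  linear_combination him

theorem X_mul_X_pow_three_notMem_idealC2 :
    (X 0 * X 1 ^ 3 : MvPolynomial (Fin 2) ℚ) ∉ idealC2 := by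
  intro h
  have hy : Ideal.Quotient.mk (Ideal.span {(Polynomial.X : Polynomial ℚ) ^ 4}) Polynomial.X ^ 4
      = 0 := by
    rw [← map_pow, Ideal.Quotient.eq_zero_iff_mem]
    exact Ideal.mem_span_singleton_self _
  have hy3 := pow_three_eq_zero_of_mem_idealC2 hy h
  rw [← map_pow, Ideal.Quotient.eq_zero_iff_mem, Ideal.mem_span_singleton,
    pow_dvd_pow_iff Polynomial.X_ne_zero Polynomial.not_isUnit_X] at hy3
  omega

/-- In `ℚ[x,y]/⟨x²+y², x⁴+y⁴⟩`, the Chern classes of `Sp(2)/T` satisfy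
`c₁⁴ = 48·c₄`, `c₁²c₂ = 24·c₄`, `c₂² = 12·c₄`, `c₁c₃ = 7·c₄` and `c₄ ≠ 0`. -/
theorem chern_numbers_Sp2_T :
    cC2 0 ^ 4 = 48 * cC2 3 ∧
    cC2 0 ^ 2 * cC2 1 = 24 * cC2 3 ∧
    cC2 1 ^ 2 = 12 * cC2 3 ∧
    cC2 0 * cC2 2 = 7 * cC2 3 ∧
    cC2 3 ≠ 0 := by
  have h2 : (Ideal.Quotient.mk idealC2 (X 0)) ^ 2 + (Ideal.Quotient.mk idealC2 (X 1)) ^ 2 = 0 := by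
    rw [← map_pow, ← map_pow, ← map_add, Ideal.Quotient.eq_zero_iff_mem]
    exact Ideal.subset_span (by simp)
  have h4 : (Ideal.Quotient.mk idealC2 (X 0)) ^ 4 + (Ideal.Quotient.mk idealC2 (X 1)) ^ 4 = 0 := by
    rw [← map_pow, ← map_pow, ← map_add, Ideal.Quotient.eq_zero_iff_mem]
    exact Ideal.subset_span (by simp)
  refine ⟨?_, ?_, ?_, ?_, fun h => X_mul_X_pow_three_notMem_idealC2 ?_⟩
  on_goal 5 =>
    have hmem := Ideal.mul_mem_left _ (C (-1 / 8)) (Ideal.Quotient.eq_zero_iff_mem.mp h)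
    have hC : (C (-1 / 8) * -8 : MvPolynomial (Fin 2) ℚ) = 1 := by
      rw [show (-8 : MvPolynomial (Fin 2) ℚ) = C (-8) by rw [map_neg, map_ofNat], ← C_mul]
      norm_num
    rwa [← mul_assoc, hC, one_mul] at hmem
  all_goals
    simp only [cC2, map_add, map_sub, map_mul, map_pow, map_neg, map_ofNat]
    set x := Ideal.Quotient.mk idealC2 (X 0)
    set y := Ideal.Quotient.mk idealC2 (X 1)
  · linear_combination (256 * x ^ 2 + 512 * x * y + 128 * y ^ 2) * h2 - 56 * (h4 - (x ^ 2 - y ^ 2) * h2)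
  · linear_combination (128 * x * y + 32 * y ^ 2) * h2 - 28 * (h4 - (x ^ 2 - y ^ 2) * h2)
  · linear_combination 64 * y ^ 2 * h2 - 14 * (h4 - (x ^ 2 - y ^ 2) * h2)
  · linear_combination -16 * y ^ 2 * h2 - 4 * (h4 - (x ^ 2 - y ^ 2) * h2)
end

section
/- In the quotient ring ℚ[x,y,z]/⟨x+y+z, x²+y²+z², x⁶+y⁶+z⁶⟩ one has (6x+4y)⁶ = 3840 · (x−y)·y·x·(x+y)·(x+2y)·(2x+y). -/
open MvPolynomial

/-- The ideal `⟨x+y+z, x²+y²+z², x⁶+y⁶+z⁶⟩` of `ℚ[x,y,z]` presenting the cohomology of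
the full flag manifold `G₂/T`. -/
noncomputable def idealG2 : Ideal (MvPolynomial (Fin 3) ℚ) :=
  Ideal.span {X 0 + X 1 + X 2, X 0 ^ 2 + X 1 ^ 2 + X 2 ^ 2, X 0 ^ 6 + X 1 ^ 6 + X 2 ^ 6}

/-- The relations `x²+xy+y² = 0` and `y⁶ = 0` in a `ℚ`-algebra in which the power sums of
degrees 1, 2 and 6 of `x, y, z` vanish. -/
theorem quadratic_and_sixth_power_eq_zero {R : Type*} [CommRing R] [Algebra ℚ R] {x y z : R}
    (h₁ : x + y + z = 0) (h₂ : x ^ 2 + y ^ 2 + z ^ 2 = 0) (h₆ : x ^ 6 + y ^ 6 + z ^ 6 = 0) :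
    x ^ 2 + x * y + y ^ 2 = 0 ∧ y ^ 6 = 0 := by
  have two : IsUnit (2 : R) := by
    simpa only [map_ofNat] using (IsUnit.mk0 (2 : ℚ) two_ne_zero).map (algebraMap ℚ R)
  have three : IsUnit (3 : R) := by
    simpa only [map_ofNat] using (IsUnit.mk0 (3 : ℚ) three_ne_zero).map (algebraMap ℚ R)
  obtain rfl : z = -(x + y) := by linear_combination h₁
  have hq : x ^ 2 + x * y + y ^ 2 = 0 :=
    two.mul_right_eq_zero.mp (by linear_combination h₂)
  refine ⟨hq, three.mul_right_eq_zero.mp ?_⟩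
  linear_combination h₆ - ((x - y) * (x ^ 3 + 2 * y ^ 3) + 3 * x ^ 2 * y ^ 2 +
    3 * x * y * (x ^ 2 + x * y + y ^ 2) + (x ^ 2 + x * y + y ^ 2) ^ 2) * hq

/-- In `ℚ[x,y,z]/⟨x+y+z, x²+y²+z², x⁶+y⁶+z⁶⟩`, the Chern number identity
`(6x+4y)⁶ = 3840·(x−y)·y·x·(x+y)·(x+2y)·(2x+y)` for the canonical invariant complex
structure on the full flag manifold `G₂/T`. -/
theorem chern_number_G2_full :
    Ideal.Quotient.mk idealG2 ((6 * X 0 + 4 * X 1) ^ 6) =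
      Ideal.Quotient.mk idealG2
        (3840 * ((X 0 - X 1) * X 1 * X 0 * (X 0 + X 1) * (X 0 + 2 * X 1) *
          (2 * X 0 + X 1))) := by
  have h : ∀ p ∈ ({X 0 + X 1 + X 2, X 0 ^ 2 + X 1 ^ 2 + X 2 ^ 2, X 0 ^ 6 + X 1 ^ 6 + X 2 ^ 6} :
      Set (MvPolynomial (Fin 3) ℚ)), Ideal.Quotient.mk idealG2 p = 0 :=
    fun p hp => Ideal.Quotient.eq_zero_iff_mem.mpr (Ideal.subset_span hp)
  simp only [Set.mem_insert_iff, Set.mem_singleton_iff, forall_eq_or_imp, forall_eq, map_add,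
    map_pow] at h
  obtain ⟨h₁, h₂, h₆⟩ := h
  obtain ⟨hq, hy⟩ := quadratic_and_sixth_power_eq_zero h₁ h₂ h₆
  simp only [map_add, map_sub, map_mul, map_pow, map_ofNat]
  generalize Ideal.Quotient.mk idealG2 (X 0) = x at hq ⊢
  generalize Ideal.Quotient.mk idealG2 (X 1) = y at hq hy ⊢
  linear_combination (-143 * 64) * hy + 64 * ((27 * (3 * x * y - 5 * y ^ 2) ^ 2 +
    243 * (3 * x * y - 5 * y ^ 2) * (x ^ 2 + x * y + y ^ 2) +
    729 * (x ^ 2 + x * y + y ^ 2) ^ 2 + 27 * (x - y) * y ^ 3 - 135 * y ^ 4) -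
    60 * (x * y * (2 * (x ^ 2 + x * y + y ^ 2) + 3 * x * y) +
    2 * x * y * (-x * y - 2 * y ^ 2) - 3 * (x - y) * y ^ 3 - 6 * y ^ 4)) * hq
end

section
/- In the quotient ring ℚ[x,y,z]/⟨x+y+z, x²+y²+z², x⁶+y⁶+z⁶⟩ one has 3·(5x+5y)⁵ = 3125 · x·y·(x+y)·(x+2y)·(2x+y). -/
open MvPolynomial

/-- In `ℚ[x,y,z]/⟨x+y+z, x²+y²+z², x⁶+y⁶+z⁶⟩`, the Chern number identity
`3·(5x+5y)⁵ = 3125·x·y·(x+y)·(x+2y)·(2x+y)` for the integrable invariant almost complex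
structure `J₁` on `G₂/U(2)` (with 3 isotropy summands). -/
theorem chern_number_G2_U2_J1 :
    Ideal.Quotient.mk idealG2 (3 * (5 * X 0 + 5 * X 1) ^ 5) =
      Ideal.Quotient.mk idealG2
        (3125 * (X 0 * X 1 * (X 0 + X 1) * (X 0 + 2 * X 1) * (2 * X 0 + X 1))) := by
  have h₁ : (X 0 + X 1 + X 2 : MvPolynomial (Fin 3) ℚ) ∈ idealG2 :=
    Ideal.subset_span (by simp)
  have h₂ : (X 0 ^ 2 + X 1 ^ 2 + X 2 ^ 2 : MvPolynomial (Fin 3) ℚ) ∈ idealG2 :=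
    Ideal.subset_span (by simp)
  have half : (C (1 / 2) : MvPolynomial (Fin 3) ℚ) * 2 = 1 := by
    rw [← map_ofNat C 2, ← C_mul]
    norm_num
  have hq : (X 0 ^ 2 + X 0 * X 1 + X 1 ^ 2 : MvPolynomial (Fin 3) ℚ) ∈ idealG2 := by
    convert idealG2.mul_mem_left (C (1 / 2))
      (idealG2.sub_mem h₂ (idealG2.mul_mem_left (X 2 - X 0 - X 1) h₁)) using 1
    linear_combination -(X 0 ^ 2 + X 0 * X 1 + X 1 ^ 2) * half
  rw [Ideal.Quotient.eq]
  convert idealG2.mul_mem_left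
    (3125 * (X 0 + X 1) * (4 * (X 0 * X 1) + 3 * (X 0 ^ 2 + X 0 * X 1 + X 1 ^ 2))) hq using 1
  ring
end

section
/- In the quotient ring ℚ[x,y,z]/⟨x+y+z, x²+y²+z², x⁶+y⁶+z⁶⟩ one has (3x+3y)⁵ = 81 · x·y·(x+y)·(x+2y)·(2x+y). -/
open MvPolynomial

/-- Eliminating `z = -x-y` from `x²+y²+z²` puts `x²+xy+y²` in `idealG2`. -/
lemma sq_add_mul_add_sq_mem_idealG2 :
    (X 0 ^ 2 + X 0 * X 1 + X 1 ^ 2 : MvPolynomial (Fin 3) ℚ) ∈ idealG2 := by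
  have h₁ : (X 0 + X 1 + X 2 : MvPolynomial (Fin 3) ℚ) ∈ idealG2 :=
    Ideal.subset_span (by simp)
  have h₂ : (X 0 ^ 2 + X 1 ^ 2 + X 2 ^ 2 : MvPolynomial (Fin 3) ℚ) ∈ idealG2 :=
    Ideal.subset_span (by simp)
  have h := idealG2.mul_mem_left (C (1 / 2))
    (idealG2.sub_mem h₂ (idealG2.mul_mem_left (X 2 - X 0 - X 1) h₁))
  have half : (C (1 / 2) * 2 : MvPolynomial (Fin 3) ℚ) = 1 := by
    rw [← map_ofNat (C (σ := Fin 3) (R := ℚ)) 2, ← C_mul]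
    norm_num
  convert h using 1
  linear_combination (-(X 0 ^ 2 + X 0 * X 1 + X 1 ^ 2)) * half

/-- In `ℚ[x,y,z]/⟨x+y+z, x²+y²+z², x⁶+y⁶+z⁶⟩`, the Chern number identity
`(3x+3y)⁵ = 81·x·y·(x+y)·(x+2y)·(2x+y)` for the non-integrable invariant almost complex
structure `J₃` on `G₂/U(2)` (with 3 isotropy summands). -/
theorem chern_number_G2_U2_J3 :
    Ideal.Quotient.mk idealG2 ((3 * X 0 + 3 * X 1) ^ 5) =
      Ideal.Quotient.mk idealG2
        (81 * (X 0 * X 1 * (X 0 + X 1) * (X 0 + 2 * X 1) * (2 * X 0 + X 1))) := by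
  rw [Ideal.Quotient.eq]
  convert idealG2.mul_mem_left
    (81 * (X 0 + X 1) * (3 * (X 0 ^ 2 + X 0 * X 1 + X 1 ^ 2) + 4 * (X 0 * X 1)))
    sq_add_mul_add_sq_mem_idealG2 using 1
  ring
end

section
/- In the quotient ring ℚ[x,y,z]/⟨x²+y²+z², x⁴+y⁴+z⁴, x⁶+y⁶+z⁶⟩, let r₁,…,r₆ denote the six linear forms x, y, z, x+y, x+z, y+z, let c₁ = r₁+⋯+r₆ = 3(x+y+z), let c₅ be the 5th elementary symmetric polynomial of r₁,…,r₆, and let c₆ = r₁·r₂·⋯·r₆. Then c₁·c₅ = 18·c₆. -/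
open MvPolynomial

/-- The ideal `⟨s₁,s₂,s₃⟩ = ⟨x²+y²+z², x⁴+y⁴+z⁴, x⁶+y⁶+z⁶⟩` of `ℚ[x,y,z]` presenting the
cohomology of `SO(7)/U(3)`. -/
noncomputable def idealB3 : Ideal (MvPolynomial (Fin 3) ℚ) :=
  Ideal.span {X 0 ^ 2 + X 1 ^ 2 + X 2 ^ 2, X 0 ^ 4 + X 1 ^ 4 + X 2 ^ 4,
    X 0 ^ 6 + X 1 ^ 6 + X 2 ^ 6}

/-- The six complementary positive roots `x, y, z, x+y, x+z, y+z` of `SO(7)/U(3)`. -/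
noncomputable def rootsB3 : Fin 6 → MvPolynomial (Fin 3) ℚ :=
  ![X 0, X 1, X 2, X 0 + X 1, X 0 + X 2, X 1 + X 2]

/-- The fifth elementary symmetric polynomial of six elements, written out. -/
theorem sum_powersetCard_five_prod {R : Type*} [CommSemiring R] (r : Fin 6 → R) :
    ∑ s ∈ Finset.powersetCard 5 (Finset.univ : Finset (Fin 6)), ∏ j ∈ s, r j =
      r 1 * r 2 * r 3 * r 4 * r 5 + r 0 * r 2 * r 3 * r 4 * r 5 + r 0 * r 1 * r 3 * r 4 * r 5 +
        r 0 * r 1 * r 2 * r 4 * r 5 + r 0 * r 1 * r 2 * r 3 * r 5 + r 0 * r 1 * r 2 * r 3 * r 4 := by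
  have h : Finset.powersetCard 5 (Finset.univ : Finset (Fin 6)) =
      Finset.univ.image fun i => Finset.univ.erase i := by decide
  have h_erase (i : Fin 6) : Finset.univ.erase i = Finset.univ.image i.succAbove := by
    rw [Fin.image_succAbove_univ, Finset.compl_singleton]
  rw [h, Finset.sum_image fun i _ j _ hij => (Finset.erase_inj _ (Finset.mem_univ i)).1 hij]
  simp only [h_erase, Finset.prod_image Fin.succAbove_right_injective.injOn, Fin.sum_univ_six,
    Fin.prod_univ_five]
  rfl

/-- In `ℚ[x,y,z]/⟨x²+y²+z², x⁴+y⁴+z⁴, x⁶+y⁶+z⁶⟩`, with `r₁,…,r₆` the six linear forms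
`x, y, z, x+y, x+z, y+z`, `c₁ = r₁+⋯+r₆`, `c₅` the 5th elementary symmetric polynomial of
the `rᵢ`, and `c₆ = r₁⋯r₆`, one has `c₁·c₅ = 18·c₆`. -/
theorem chern_number_SO7_U3 :
    Ideal.Quotient.mk idealB3 ((∑ i, rootsB3 i) *
        (∑ s ∈ Finset.powersetCard 5 (Finset.univ : Finset (Fin 6)), ∏ j ∈ s, rootsB3 j)) =
      Ideal.Quotient.mk idealB3 (18 * ∏ i, rootsB3 i) := by
  rw [Ideal.Quotient.eq, sum_powersetCard_five_prod]
  have h₂ : (X 0 ^ 2 + X 1 ^ 2 + X 2 ^ 2 : MvPolynomial (Fin 3) ℚ) ∈ idealB3 :=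
    Ideal.subset_span (by simp)
  have h₄ : (X 0 ^ 4 + X 1 ^ 4 + X 2 ^ 4 : MvPolynomial (Fin 3) ℚ) ∈ idealB3 :=
    Ideal.subset_span (by simp)
  have h₆ : (X 0 ^ 6 + X 1 ^ 6 + X 2 ^ 6 : MvPolynomial (Fin 3) ℚ) ∈ idealB3 :=
    Ideal.subset_span (by simp)
  have half : 2 * C (1 / 2) = (1 : MvPolynomial (Fin 3) ℚ) := by
    rw [← map_ofNat (C : ℚ →+* MvPolynomial (Fin 3) ℚ) 2, ← C_mul]
    norm_num
  have key := add_mem (add_mem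
    (idealB3.mul_mem_left
      (3 * C (1 / 2) * (X 0 + X 1 + X 2) ^ 2 * (X 0 ^ 2 + X 1 ^ 2 + X 2 ^ 2)
        + 9 * (X 0 + X 1 + X 2) * (X 0 * X 1 * X 2)
        + 3 * (X 0 ^ 2 + X 1 ^ 2 + X 2 ^ 2) ^ 2) h₂)
    (idealB3.mul_mem_left
      (-3 * C (1 / 2) * (X 0 + X 1 + X 2) ^ 2 - 9 * (X 0 ^ 2 + X 1 ^ 2 + X 2 ^ 2)) h₄))
    (idealB3.mul_mem_left 6 h₆)
  convert key using 1
  simp only [Fin.sum_univ_six, Fin.prod_univ_six, rootsB3, Matrix.cons_val]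
  linear_combination -3 * (X 0 + X 1 + X 2) ^ 2 *
    ((X 0 * X 1 + X 0 * X 2 + X 1 * X 2) ^ 2
      - 2 * (X 0 + X 1 + X 2) * (X 0 * X 1 * X 2)) * half
end
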